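/- arXiv:2310.11219 — 2 statements merged into one kernel-verified Lean document; each statement's English description precedes it below -/
import Mathlib

section
/- Let K ⊂ ℝ² be a compact sub-uniformly distributed set with dimH(K) = t ∈ (0,2), and let s satisfy max{t−1, 0} < s ≤ 1. Then for a.e. e ∈ S¹ one has dimH(H(K,e,s)) ≤ max{t−s, 0}. -/
open MeasureTheory Metric Set
open scoped ENNReal NNReal

noncomputable section

/-- The Euclidean plane ℝ². -/
abbrev Plane := EuclideanSpace ℝ (Fin 2)

/-- The unit circle S¹ ⊆ ℝ². -/
def unitCircle : Set Plane := Metric.sphere (0 : Plane) 1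

/-- The line `ℓ_{e,z} = z + span(e)` through `z` in direction `e`. -/
def lineThrough (e z : Plane) : Set Plane := {w | ∃ r : ℝ, w = z + r • e}


/-- The `s`-heavy part of `A` in direction `e`:
`H(A,e,s) = {z ∈ A : dimH (A ∩ ℓ_{e,z}) ≥ s}`. -/
def heavyPart (A : Set Plane) (e : Plane) (s : ℝ) : Set Plane :=
  {z | z ∈ A ∧ ENNReal.ofReal s ≤ dimH (A ∩ lineThrough e z)}


/-- The standard (half-open) dyadic cube of side length `2^{-k}` indexed by `m : Fin d → ℤ`. -/
def dyadicCube (d k : ℕ) (m : Fin d → ℤ) : Set (EuclideanSpace ℝ (Fin d)) :=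
  {x | ∀ i, (m i : ℝ) * (2 : ℝ) ^ (-(k : ℤ)) ≤ x i ∧
            x i < ((m i : ℝ) + 1) * (2 : ℝ) ^ (-(k : ℤ))}

/-- The dyadic `2^{-k}`-covering number `|P|_{2^{-k}}`: the number of standard dyadic cubes of
side length `2^{-k}` intersecting `P`. -/
def covNum (d k : ℕ) (P : Set (EuclideanSpace ℝ (Fin d))) : ℕ :=
  Set.ncard {m : Fin d → ℤ | (dyadicCube d k m ∩ P).Nonempty}

/-- A bounded set `K ⊆ ℝ^d` is sub-uniformly distributed if there is `C > 0` with
`|K|_R · |K ∩ Q|_r ≤ C·|K|_r` for all dyadic scales `r = 2^{-k} ≤ R = 2^{-j}` and every dyadic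
`R`-cube `Q` intersecting `K`. -/
def SubUniformlyDistributed {d : ℕ} (K : Set (EuclideanSpace ℝ (Fin d))) : Prop :=
  Bornology.IsBounded K ∧ ∃ C : ℝ, 0 < C ∧ ∀ j k : ℕ, j ≤ k → ∀ m : Fin d → ℤ,
    (dyadicCube d j m ∩ K).Nonempty →
    (covNum d j K : ℝ) * (covNum d k (K ∩ dyadicCube d j m) : ℝ)
      ≤ C * (covNum d k K : ℝ)

lemma half_kernel (h : ℝ → ℝ) (hc : Continuous h) (w : ℝ)
    (hw : ∀ x, w < |x| → h x = 0) (h0 : ∫ x, h x = 0) (R : ℝ) (hR : 0 < R) (hRw : 2 * w ≤ R)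
    (hw0 : 0 < w) :
    |∫ θ in (-(Real.pi/2))..(Real.pi/2), h (R * Real.sin θ)| ≤ 2 * w^2 * (∫ x, |h x|) / R^3 := by
  have key : ∀ g : ℝ → ℝ, Continuous g → (∀ x, w < |x| → g x = 0) →
      ∫ θ in (-(Real.pi/2))..(Real.pi/2), g (R * Real.sin θ) * Real.cos θ = (∫ x, g x) / R := by
    intro g hg hgw
    have := intervalIntegral.integral_comp_mul_deriv (a := -(Real.pi/2)) (b := Real.pi/2)
      (f := fun θ => R * Real.sin θ) (f' := fun θ => R * Real.cos θ) (g := g)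
      (fun x _ => (Real.hasDerivAt_sin x).const_mul R) (by fun_prop) hg
    simp only [Function.comp, Real.sin_neg, Real.sin_pi_div_two, mul_neg, mul_one] at this
    have h2 : ∫ x in (-R)..R, g x = ∫ x, g x := by
      apply intervalIntegral.integral_eq_integral_of_support_subset
      intro x hx
      by_contra hx'
      apply hx
      apply hgw
      simp only [mem_Ioc, not_and_or, not_lt, not_le] at hx'
      rcases hx' with hx' | hx'
      · rw [lt_abs]; right; linarith
      · rw [lt_abs]; left; linarith
    rw [h2] at this
    rw [← this, eq_div_iff hR.ne', mul_comm, ← intervalIntegral.integral_const_mul]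
    congr 1; ext x; ring
  have k1 := key h hc hw
  rw [h0, zero_div] at k1
  have k2 := key (fun x => |h x|) (by fun_prop) (fun x hx => by simp [hw x hx])
  have e1 : ∫ θ in (-(Real.pi/2))..(Real.pi/2), h (R * Real.sin θ)
      = ∫ θ in (-(Real.pi/2))..(Real.pi/2), h (R * Real.sin θ) * (1 - Real.cos θ) := by
    have : ∀ θ, h (R * Real.sin θ) * (1 - Real.cos θ)
      = h (R * Real.sin θ) - h (R * Real.sin θ) * Real.cos θ := fun θ => by ring
    simp_rw [this]
    rw [intervalIntegral.integral_sub, k1, sub_zero]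
    · exact Continuous.intervalIntegrable (by fun_prop) _ _
    · exact Continuous.intervalIntegrable (by fun_prop) _ _
  have hpi := Real.pi_pos
  rw [e1]
  calc |∫ θ in (-(Real.pi/2))..(Real.pi/2), h (R * Real.sin θ) * (1 - Real.cos θ)|
      ≤ ∫ θ in (-(Real.pi/2))..(Real.pi/2), |h (R * Real.sin θ) * (1 - Real.cos θ)| :=
        intervalIntegral.abs_integral_le_integral_abs (by linarith)
    _ ≤ ∫ θ in (-(Real.pi/2))..(Real.pi/2), (2 * w^2 / R^2) * (|h (R * Real.sin θ)| * Real.cos θ) := by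
        apply intervalIntegral.integral_mono_on (by linarith)
        · exact Continuous.intervalIntegrable (by fun_prop) _ _
        · exact Continuous.intervalIntegrable (by fun_prop) _ _
        intro θ hθ
        have hcos : 0 ≤ Real.cos θ := Real.cos_nonneg_of_mem_Icc hθ
        by_cases hs : w < |R * Real.sin θ|
        · rw [hw _ hs]; simp
        · push Not at hs
          have hs2 : (R * Real.sin θ)^2 ≤ w^2 := by
            rw [← sq_abs]; gcongr
          have hsc := Real.sin_sq_add_cos_sq θ
          have hs3 : Real.sin θ ^2 ≤ w^2 / R^2 := by
            rw [le_div_iff₀ (by positivity)]; nlinarith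
          have hq : w^2/R^2 ≤ 1/4 := by
            rw [div_le_iff₀ (by positivity)]; nlinarith
          have hc2 : 1/2 ≤ Real.cos θ := by nlinarith
          have h1c : 0 ≤ 1 - Real.cos θ := by linarith [Real.cos_le_one θ]
          rw [abs_mul, abs_of_nonneg h1c]
          have : 1 - Real.cos θ ≤ 2 * w^2/R^2 * Real.cos θ := by
            have : 1 - Real.cos θ ≤ Real.sin θ ^ 2 := by nlinarith
            have h3 : w^2/R^2 * 1 ≤ w^2/R^2 * (2 * Real.cos θ) := by
              gcongr; linarith
            have h4 : 2 * w^2/R^2 * Real.cos θ = w^2/R^2 * (2 * Real.cos θ) := by ring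
            linarith
          calc _ ≤ |h (R * Real.sin θ)| * (2 * w^2/R^2 * Real.cos θ) := by gcongr
            _ = _ := by ring
    _ = 2 * w^2 * (∫ x, |h x|) / R^3 := by
        rw [intervalIntegral.integral_const_mul, k2]; field_simp

lemma full_kernel_eq (h : ℝ → ℝ) (hc : Continuous h) (R α : ℝ) :
    ∫ θ in (-Real.pi)..Real.pi, h (R * Real.sin (α - θ))
      = 2 * ∫ θ in (-(Real.pi/2))..(Real.pi/2), h (R * Real.sin θ) := by
  have e1 := intervalIntegral.integral_comp_sub_left (a := -Real.pi) (b := Real.pi)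
    (fun θ => h (R * Real.sin θ)) α
  rw [e1]
  have hper : Function.Periodic (fun θ => h (R * Real.sin θ)) (2 * Real.pi) := by
    intro x; simp [Real.sin_add_two_pi]
  have e2 := hper.intervalIntegral_add_eq (α - Real.pi) (-(Real.pi/2))
  have e3 : α - Real.pi + 2 * Real.pi = α - -Real.pi := by ring
  rw [e3] at e2
  rw [e2]
  have e4 := intervalIntegral.integral_comp_sub_left (a := -(Real.pi/2)) (b := Real.pi/2)
    (fun θ => h (R * Real.sin θ)) Real.pi
  have e5 : Real.pi - Real.pi/2 = Real.pi/2 := by ring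
  have e6 : Real.pi - -(Real.pi/2) = -(Real.pi/2) + 2 * Real.pi := by ring
  rw [e5, e6] at e4
  simp only [Real.sin_pi_sub] at e4
  rw [← intervalIntegral.integral_add_adjacent_intervals (b := Real.pi/2), ← e4]
  · ring
  · exact Continuous.intervalIntegrable (by fun_prop) _ _
  · exact Continuous.intervalIntegrable (by fun_prop) _ _

lemma full_kernel (h : ℝ → ℝ) (hc : Continuous h) (w M : ℝ) (hw0 : 0 < w)
    (hw : ∀ x, w < |x| → h x = 0) (hM : ∀ x, |h x| ≤ M) (h0 : ∫ x, h x = 0) :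
    ∃ C : ℝ, 0 ≤ C ∧ ∀ R α : ℝ, 
      |∫ θ in (-Real.pi)..Real.pi, h (R * Real.sin (α - θ))| ≤ C ∧ 
      (0 < R → |∫ θ in (-Real.pi)..Real.pi, h (R * Real.sin (α - θ))| ≤ C / R^3) := by
  have hM0 : 0 ≤ M := (abs_nonneg _).trans (hM 0)
  have hpi := Real.pi_pos
  have hN : 0 ≤ ∫ x, |h x| := integral_nonneg (fun x => abs_nonneg _)
  have triv : ∀ R α : ℝ, |∫ θ in (-Real.pi)..Real.pi, h (R * Real.sin (α - θ))| 
      ≤ 2 * Real.pi * M := by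
    intro R α
    have := intervalIntegral.norm_integral_le_of_norm_le_const (a := -Real.pi) (b := Real.pi)
      (f := fun θ => h (R * Real.sin (α - θ))) (C := M) (fun x _ => hM _)
    rw [Real.norm_eq_abs] at this
    refine this.trans (le_of_eq ?_)
    rw [abs_of_nonneg (by linarith)]; ring
  refine ⟨2 * Real.pi * M + 2 * Real.pi * M * (2*w)^3 + 4 * w^2 * ∫ x, |h x|, by positivity, ?_⟩
  intro R α
  refine ⟨(triv R α).trans ?_, ?_⟩
  · have : 0 ≤ 2 * Real.pi * M * (2*w)^3 := by positivity
    have : 0 ≤ 4 * w^2 * ∫ x, |h x| := by positivity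
    linarith
  intro hR
  by_cases hRw : 2 * w ≤ R
  · rw [full_kernel_eq h hc, abs_mul, abs_two]
    have := half_kernel h hc w hw h0 R hR hRw hw0
    calc _ ≤ 2 * (2 * w^2 * (∫ x, |h x|) / R^3) := by gcongr
      _ = (4 * w^2 * ∫ x, |h x|) / R^3 := by ring
      _ ≤ _ := by
        gcongr
        have : 0 ≤ 2 * Real.pi * M * (2*w)^3 := by positivity
        have : 0 ≤ 2 * Real.pi * M := by positivity
        linarith
  · push Not at hRw
    refine (triv R α).trans ?_
    rw [le_div_iff₀ (by positivity)]
    have : R^3 ≤ (2*w)^3 := by gcongr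
    have h1 : 2 * Real.pi * M * R^3 ≤ 2 * Real.pi * M * (2*w)^3 := by gcongr
    have : 0 ≤ 4 * w^2 * ∫ x, |h x| := by positivity
    have : 0 ≤ 2 * Real.pi * M := by positivity
    linarith

/-- projection of lattice vectors -/
def prj (θ : ℝ) (v : Fin 2 → ℤ) : ℝ := Real.cos θ * (v 1 : ℝ) - Real.sin θ * (v 0 : ℝ)

lemma prj_sub (θ : ℝ) (v w : Fin 2 → ℤ) : prj θ (v - w) = prj θ v - prj θ w := by
  simp [prj]; ring

lemma polar (x y : ℝ) : ∃ R α : ℝ, 0 ≤ R ∧ R^2 = x^2 + y^2 ∧ x = R * Real.cos α ∧ y = R * Real.sin α := by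
  refine ⟨‖(⟨x, y⟩ : ℂ)‖, Complex.arg ⟨x, y⟩, norm_nonneg _, ?_, ?_, ?_⟩
  · rw [Complex.sq_norm, Complex.normSq_mk]; ring
  · rw [Complex.norm_mul_cos_arg]
  · rw [Complex.norm_mul_sin_arg]

lemma lattice_kernel (h : ℝ → ℝ) (hc : Continuous h) (w M : ℝ) (hw0 : 0 < w)
    (hw : ∀ x, w < |x| → h x = 0) (hM : ∀ x, |h x| ≤ M) (h0 : ∫ x, h x = 0) :
    ∃ k : (Fin 2 → ℤ) → ℝ, (∀ v, 0 ≤ k v) ∧ Summable k ∧ 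
      ∀ v, ∫ θ in (-Real.pi)..Real.pi, h (prj θ v) ≤ k v := by
  obtain ⟨C, hC0, hC⟩ := full_kernel h hc w M hw0 hw hM h0
  refine ⟨fun v => C * (if v = 0 then 1 else 0) + C * ‖v‖ ^ (-(3:ℝ)), ?_, ?_, ?_⟩
  · intro v; positivity
  · apply Summable.add
    · apply Summable.mul_left
      apply summable_of_finite_support
      refine (Set.finite_singleton (0 : Fin 2 → ℤ)).subset ?_
      intro v hv
      by_contra hv'
      exact hv (if_neg hv')
    · exact (EisensteinSeries.summable_one_div_norm_rpow (by norm_num)).mul_left C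
  · intro v
    obtain ⟨R, α, hR0, hR2, hx, hy⟩ := polar (v 0 : ℝ) (v 1 : ℝ)
    have e : ∀ θ, prj θ v = R * Real.sin (α - θ) := by
      intro θ; rw [prj, hx, hy, Real.sin_sub]; ring
    simp_rw [e]
    have hh := hC R α
    by_cases hv : v = 0
    · have : 0 ≤ C * ‖v‖ ^ (-(3:ℝ)) := by positivity
      simp only [hv, if_true] at this ⊢
      linarith [le_abs_self (∫ θ in (-Real.pi)..Real.pi, h (R * Real.sin (α - θ))), hh.1]
    · simp only [hv, if_false, mul_zero, zero_add]
      have hvn : 0 < ‖v‖ := norm_pos_iff.mpr hv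
      have hRv : ‖v‖ ≤ R := by
        rw [pi_norm_le_iff_of_nonneg hR0]
        intro i
        rw [Int.norm_eq_abs]
        apply abs_le_of_sq_le_sq _ hR0
        rw [hR2]
        fin_cases i <;> simp <;> positivity
      have hRp : 0 < R := hvn.trans_le hRv
      refine (le_abs_self _).trans ((hh.2 hRp).trans ?_)
      rw [div_eq_mul_inv]
      gcongr
      rw [Real.rpow_neg hvn.le]
      gcongr
      have : (3:ℝ) = ((3:ℕ):ℝ) := by norm_num
      rw [this, Real.rpow_natCast]
      gcongr

/-- trapezoid bump -/
def chi (x : ℝ) : ℝ := max 0 (min 1 (2 - |x|))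

lemma chi_cont : Continuous chi := by unfold chi; fun_prop
lemma chi_nonneg (x : ℝ) : 0 ≤ chi x := le_max_left _ _
lemma chi_le_one (x : ℝ) : chi x ≤ 1 := max_le zero_le_one (min_le_left _ _)
lemma chi_neg (x : ℝ) : chi (-x) = chi x := by simp [chi]
lemma chi_eq_one {x : ℝ} (hx : |x| ≤ 1) : chi x = 1 := by
  unfold chi; rw [min_eq_left (by linarith)]; simp
lemma chi_eq_zero {x : ℝ} (hx : 2 < |x|) : chi x = 0 := by
  unfold chi; apply max_eq_left; exact (min_le_right _ _).trans (by linarith)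

def psi (A x : ℝ) : ℝ := chi (x / 7) - A⁻¹ * chi (x / (7 * A))

lemma psi_cont (A : ℝ) : Continuous (psi A) := by
  unfold psi; have := chi_cont; fun_prop
lemma psi_neg (A x : ℝ) : psi A (-x) = psi A x := by
  simp [psi, neg_div, chi_neg]
lemma psi_eq_zero {A : ℝ} (hA : 1 ≤ A) {x : ℝ} (hx : 14 * A < |x|) : psi A x = 0 := by
  have h0 : 0 < A := by linarith
  unfold psi
  rw [chi_eq_zero, chi_eq_zero]
  · simp
  · rw [abs_div, abs_of_pos (by positivity : 0 < 7 * A), lt_div_iff₀ (by positivity)]; linarith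
  · rw [abs_div, abs_of_pos (by norm_num : (0:ℝ) < 7), lt_div_iff₀ (by positivity)]; linarith

lemma compactSupport_of {f : ℝ → ℝ} {w : ℝ} (hf : ∀ x, w < |x| → f x = 0) : HasCompactSupport f := by
  apply HasCompactSupport.intro (isCompact_Icc (a := -w) (b := w))
  intro x hx
  apply hf
  by_contra h
  push Not at h
  exact hx (abs_le.mp h)

lemma psi_cs {A : ℝ} (hA : 1 ≤ A) : HasCompactSupport (psi A) :=
  compactSupport_of (fun _ hx => psi_eq_zero hA hx)

lemma psi_int {A : ℝ} (hA : 1 ≤ A) : Integrable (psi A) :=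
  (psi_cont A).integrable_of_hasCompactSupport (psi_cs hA)

lemma chi_int (c : ℝ) (hc : 0 < c) : Integrable (fun x => chi (x / c)) := by
  apply Continuous.integrable_of_hasCompactSupport
  · have := chi_cont; fun_prop
  · apply compactSupport_of (w := 2 * c)
    intro x hx
    apply chi_eq_zero
    rw [abs_div, abs_of_pos hc, lt_div_iff₀ hc]; exact hx

lemma psi_integral {A : ℝ} (hA : 1 ≤ A) : ∫ x, psi A x = 0 := by
  have h0 : 0 < A := by linarith
  unfold psi
  rw [integral_sub (chi_int 7 (by norm_num)) ((chi_int (7*A) (by positivity)).const_mul _),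
    integral_const_mul, Measure.integral_comp_div, Measure.integral_comp_div]
  rw [abs_of_pos (by positivity : 0 < 7 * A), abs_of_pos (by norm_num : (0:ℝ) < 7)]
  simp only [smul_eq_mul]
  field_simp
  ring

def ker (A : ℝ) : ℝ → ℝ := convolution (psi A) (psi A) (ContinuousLinearMap.mul ℝ ℝ) volume

lemma ker_apply (A x : ℝ) : ker A x = ∫ t, psi A t * psi A (x - t) := rfl

lemma ker_cont {A : ℝ} (hA : 1 ≤ A) : Continuous (ker A) :=
  HasCompactSupport.continuous_convolution_left _ (psi_cs hA) (psi_cont A) (psi_int hA).locallyIntegrable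

lemma ker_eq_zero {A : ℝ} (hA : 1 ≤ A) {x : ℝ} (hx : 28 * A < |x|) : ker A x = 0 := by
  rw [ker_apply]
  apply integral_eq_zero_of_ae
  refine Filter.Eventually.of_forall (fun t => ?_)
  by_cases ht : 14 * A < |t|
  · simp [psi_eq_zero hA ht]
  · have : 14 * A < |x - t| := by
      have := abs_sub_abs_le_abs_sub x t
      linarith
    simp [psi_eq_zero hA this]

lemma ker_integral {A : ℝ} (hA : 1 ≤ A) : ∫ x, ker A x = 0 := by
  unfold ker
  rw [integral_convolution _ (psi_int hA) (psi_int hA), psi_integral hA]; simp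

lemma energy_kernel {A : ℝ} (hA : 1 ≤ A) :
    ∃ k : (Fin 2 → ℤ) → ℝ, (∀ v, 0 ≤ k v) ∧ Summable k ∧ 
      ∀ v, ∫ θ in (-Real.pi)..Real.pi, ker A (prj θ v) ≤ k v := by
  obtain ⟨M, hM⟩ := (compactSupport_of (fun _ hx => ker_eq_zero hA hx)).exists_bound_of_continuous
    (ker_cont hA)
  exact lattice_kernel (ker A) (ker_cont hA) (28 * A) M (by linarith) (fun _ hx => ker_eq_zero hA hx)
    hM (ker_integral hA)

lemma psi_mul_int {A : ℝ} (hA : 1 ≤ A) (a b : ℝ) :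
    Integrable (fun u => psi A (a - u) * psi A (b - u)) := by
  have := psi_cont A
  apply Continuous.integrable_of_hasCompactSupport (by fun_prop)
  apply compactSupport_of (w := 14 * A + |a|)
  intro u hu
  rw [psi_eq_zero hA, zero_mul]
  have := abs_sub_abs_le_abs_sub u a
  rw [abs_sub_comm]; linarith

lemma ker_shift {A : ℝ} (a b : ℝ) :
    ∫ u, psi A (a - u) * psi A (b - u) = ker A (a - b) := by
  rw [ker_apply, ← integral_sub_left_eq_self (fun t => psi A t * psi A (a - b - t)) volume a]
  congr 1; ext u
  rw [← psi_neg A (b - u)]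
  congr 2; ring

def energy {ι : Type*} (A : ℝ) (P : Finset ι) (q : ι → ℝ) : ℝ :=
  ∑ m ∈ P, ∑ m' ∈ P, ker A (q m - q m')

lemma energy_eq {ι : Type*} {A : ℝ} (hA : 1 ≤ A) (P : Finset ι) (q : ι → ℝ) :
    Integrable (fun u => (∑ m ∈ P, psi A (q m - u))^2) ∧ 
    ∫ u, (∑ m ∈ P, psi A (q m - u))^2 = energy A P q := by
  have e : ∀ u, (∑ m ∈ P, psi A (q m - u))^2 = 
      ∑ m ∈ P, ∑ m' ∈ P, psi A (q m - u) * psi A (q m' - u) := by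
    intro u; rw [sq, Finset.sum_mul_sum]
  simp_rw [e]
  constructor
  · exact integrable_finset_sum _ (fun m _ => integrable_finset_sum _ (fun m' _ => psi_mul_int hA _ _))
  · rw [integral_finset_sum _ (fun m _ => integrable_finset_sum _ (fun m' _ => psi_mul_int hA _ _))]
    unfold energy
    refine Finset.sum_congr rfl (fun m _ => ?_)
    rw [integral_finset_sum _ (fun m' _ => psi_mul_int hA _ _)]
    exact Finset.sum_congr rfl (fun m' _ => ker_shift _ _)

lemma energy_nonneg {ι : Type*} {A : ℝ} (hA : 1 ≤ A) (P : Finset ι) (q : ι → ℝ) :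
    0 ≤ energy A P q := by
  rw [← (energy_eq hA P q).2]; exact integral_nonneg (fun u => sq_nonneg _)

lemma count_bound {ι : Type*} {A : ℝ} (hA : 1 ≤ A) (P F : Finset ι) (hF : F ⊆ P) (q : ι → ℝ)
    (lam : ℝ) (hl : 0 < lam)
    (h : ∀ m ∈ F, ∀ u, |q m - u| ≤ 1 → lam ≤ ∑ m' ∈ P, chi ((q m' - u)/7) ∧ 
      A⁻¹ * ∑ m' ∈ P, chi ((q m' - u)/(7*A)) ≤ lam / 2) :
    (F.card : ℝ) * lam ≤ 2 * energy A P q := by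
  classical
  have hintg : ∀ m : ι, Integrable (indicator (Icc (q m - 1) (q m + 1)) (fun _ => (1:ℝ))) := by
    intro m
    rw [integrable_indicator_iff measurableSet_Icc]
    exact continuous_const.integrableOn_Icc
  have pt : ∀ u, (lam/4) * ∑ m ∈ F, indicator (Icc (q m - 1) (q m + 1)) (fun _ => (1:ℝ)) u
      ≤ (∑ m ∈ P, psi A (q m - u))^2 := by
    intro u
    by_cases hu : ∃ m ∈ F, |q m - u| ≤ 1
    · obtain ⟨m, hm, hmu⟩ := hu
      obtain ⟨h1, h2⟩ := h m hm u hmu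
      have e : ∑ m ∈ P, psi A (q m - u) = ∑ m' ∈ P, chi ((q m' - u)/7)
          - A⁻¹ * ∑ m' ∈ P, chi ((q m' - u)/(7*A)) := by
        unfold psi; rw [Finset.sum_sub_distrib, Finset.mul_sum]
      have h3 : ∑ m ∈ F, indicator (Icc (q m - 1) (q m + 1)) (fun _ => (1:ℝ)) u ≤
          ∑ m' ∈ P, chi ((q m' - u)/7) := by
        refine (Finset.sum_le_sum (fun i _ => ?_)).trans
          (Finset.sum_le_sum_of_subset_of_nonneg hF (fun i _ _ => chi_nonneg _))
        by_cases hi : u ∈ Icc (q i - 1) (q i + 1)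
        · rw [indicator_of_mem hi, chi_eq_one]
          rw [abs_div, abs_of_pos (by norm_num : (0:ℝ) < 7), div_le_one (by norm_num), abs_le]
          constructor <;> linarith [hi.1, hi.2]
        · rw [indicator_of_notMem hi]; exact chi_nonneg _
      rw [e]
      set a := ∑ m' ∈ P, chi ((q m' - u)/7)
      have h4 : a / 2 ≤ a - A⁻¹ * ∑ m' ∈ P, chi ((q m' - u)/(7*A)) := by linarith
      have h5 : (a/2)^2 ≤ (a - A⁻¹ * ∑ m' ∈ P, chi ((q m' - u)/(7*A)))^2 := by
        apply pow_le_pow_left₀ _ h4; linarith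
      refine le_trans ?_ h5
      calc _ ≤ lam/4 * a := by gcongr
        _ ≤ a / 4 * a := by gcongr; linarith
        _ = _ := by ring
    · push Not at hu
      rw [Finset.sum_eq_zero]
      · simp; positivity
      · intro m hm
        apply indicator_of_notMem
        intro hmem
        have := hu m hm
        have h2 : |q m - u| ≤ 1 := by
          rw [abs_le]; constructor <;> linarith [hmem.1, hmem.2]
        linarith
  have := integral_mono (μ := volume) ((integrable_finset_sum F (fun m _ => hintg m)).const_mul (lam/4))
    (energy_eq hA P q).1 pt
  rw [(energy_eq hA P q).2, integral_const_mul, integral_finset_sum _ (fun m _ => hintg m)] at this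
  have e2 : ∀ m : ι, ∫ u, indicator (Icc (q m - 1) (q m + 1)) (fun _ => (1:ℝ)) u = 2 := by
    intro m
    rw [integral_indicator measurableSet_Icc]
    simp
    norm_num
  simp_rw [e2] at this
  simp at this
  linarith

lemma energy_cont {A : ℝ} (hA : 1 ≤ A) (P : Finset (Fin 2 → ℤ)) :
    Continuous (fun θ => energy A P (prj θ)) := by
  unfold energy prj
  have := ker_cont hA
  fun_prop

/-- averaged energy bound -/
lemma energy_avg {A : ℝ} (hA : 1 ≤ A) : ∃ C : ℝ, 0 ≤ C ∧ ∀ P : Finset (Fin 2 → ℤ),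
    ∫ θ in (-Real.pi)..Real.pi, energy A P (prj θ) ≤ C * P.card := by
  obtain ⟨k, hk0, hks, hk⟩ := energy_kernel hA
  refine ⟨∑' v, k v, tsum_nonneg hk0, fun P => ?_⟩
  have hkc := ker_cont hA
  have hp : ∀ v, Continuous (fun θ => prj θ v) := by intro v; unfold prj; fun_prop
  have hi : ∀ v, IntervalIntegrable (fun θ => ker A (prj θ v)) volume (-Real.pi) Real.pi :=
    fun v => Continuous.intervalIntegrable (hkc.comp (hp v)) _ _
  unfold energy
  simp_rw [← prj_sub]
  rw [intervalIntegral.integral_finset_sum]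
  swap
  · intro m _
    apply Continuous.intervalIntegrable
    exact continuous_finset_sum _ (fun i _ => hkc.comp (hp _))
  calc _ ≤ ∑ m ∈ P, ∑' v, k v := by
        apply Finset.sum_le_sum
        intro m _
        rw [intervalIntegral.integral_finset_sum (fun i _ => hi _)]
        calc _ ≤ ∑ m' ∈ P, k (m - m') := Finset.sum_le_sum (fun i _ => hk _)
          _ ≤ ∑' m', k (m - m') := by
            apply Summable.sum_le_tsum _ (fun i _ => hk0 _)
            exact ((Equiv.subLeft m).summable_iff (f := k)).mpr hks
          _ = ∑' v, k v := (Equiv.subLeft m).tsum_eq k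
    _ = _ := by rw [Finset.sum_const, nsmul_eq_mul, mul_comm]

/-- a.e. direction energy bound -/
lemma energy_ae {A : ℝ} (hA : 1 ≤ A) (P : ℕ → Finset (Fin 2 → ℤ)) (hP : ∀ k, (P k).Nonempty)
    (ε : ℝ) (hε : 0 < ε) :
    ∀ᵐ θ ∂(volume.restrict (Ioc (-Real.pi) Real.pi)), ∃ C : ℝ, 0 < C ∧ 
      ∀ k : ℕ, energy A (P k) (prj θ) ≤ C * ((P k).card * (2:ℝ)^(k * ε)) := by
  obtain ⟨C, hC0, hC⟩ := energy_avg hA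
  have hpi := Real.pi_pos
  have hn : ∀ k, (0:ℝ) < (P k).card := fun k => by exact_mod_cast (hP k).card_pos
  let w : ℕ → ℝ := fun k => ((P k).card * (2:ℝ)^(k * ε))⁻¹
  have hw : ∀ k, 0 < w k := fun k => by have := hn k; positivity
  let f : ℕ → ℝ → ℝ≥0∞ := fun k θ => ENNReal.ofReal (w k * energy A (P k) (prj θ))
  have hfm : ∀ k, Measurable (f k) := fun k =>
    ((energy_cont hA (P k)).measurable.const_mul (w k)).ennreal_ofReal
  have hb : ∀ k, ∫⁻ θ in Ioc (-Real.pi) Real.pi, f k θ ≤ ENNReal.ofReal (C * ((2:ℝ)^(-ε))^k) := by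
    intro k
    rw [← ofReal_integral_eq_lintegral_ofReal]
    · apply ENNReal.ofReal_le_ofReal
      rw [integral_const_mul, ← intervalIntegral.integral_of_le (by linarith)]
      have := hC (P k)
      calc _ ≤ w k * (C * (P k).card) := by have := (hw k).le; gcongr
        _ = _ := by
          have := hn k
          rw [← Real.rpow_natCast, ← Real.rpow_mul (by norm_num)]
          have e : -ε * (k:ℝ) = -(k * ε) := by ring
          rw [e, Real.rpow_neg (by norm_num)]
          simp only [w]
          field_simp
    · exact (((energy_cont hA (P k)).const_mul (w k)).integrableOn_Icc).mono_set Ioc_subset_Icc_self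
    · exact Filter.Eventually.of_forall (fun θ => mul_nonneg (hw k).le (energy_nonneg hA _ _))
  have hs : ∫⁻ θ in Ioc (-Real.pi) Real.pi, ∑' k, f k θ ≠ ∞ := by
    rw [lintegral_tsum (fun k => (hfm k).aemeasurable)]
    refine ne_top_of_le_ne_top ?_ (ENNReal.tsum_le_tsum hb)
    have hsum : Summable (fun k : ℕ => C * ((2:ℝ)^(-ε))^k) := by
      apply Summable.mul_left
      apply summable_geometric_of_lt_one (by positivity)
      exact Real.rpow_lt_one_of_one_lt_of_neg (by norm_num) (by linarith)
    rw [← ENNReal.ofReal_tsum_of_nonneg (fun k => by positivity) hsum]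
    exact ENNReal.ofReal_ne_top
  have := ae_lt_top (Measurable.ennreal_tsum hfm) hs
  filter_upwards [this] with θ hθ
  refine ⟨(∑' k, f k θ).toReal + 1, by positivity, fun k => ?_⟩
  have h1 : f k θ ≤ ∑' k, f k θ := ENNReal.le_tsum k
  have h2 := (ENNReal.ofReal_le_iff_le_toReal hθ.ne).mp h1
  have h3 : 0 < ((P k).card * (2:ℝ)^(k * ε)) := by have := hn k; positivity
  simp only [w] at h2
  rw [inv_mul_le_iff₀ h3] at h2
  rw [mul_comm]
  refine h2.trans ?_
  gcongr
  linarith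

lemma content_zero {X : Type*} [EMetricSpace X] [MeasurableSpace X] [BorelSpace X]
    {β : Type*} [Countable β] (d : ℝ) (hd : 0 < d) (S : Set X)
    (h : ∀ δ : ℝ, 0 < δ → ∃ t : β → Set X, S ⊆ ⋃ i, t i ∧ ∑' i, ediam (t i) ^ d ≤ ENNReal.ofReal δ) :
    μH[d] S = 0 := by
  have h' := fun n : ℕ => h (1 / ((n:ℝ) + 1)) (by positivity)
  choose t ht1 ht2 using h'
  have hlim : Filter.Tendsto (fun n : ℕ => ENNReal.ofReal (1 / ((n:ℝ) + 1))) Filter.atTop (nhds 0) := by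
    have := ENNReal.tendsto_ofReal (tendsto_one_div_add_atTop_nhds_zero_nat (𝕜 := ℝ))
    simpa using this
  have hr : Filter.Tendsto (fun n : ℕ => (ENNReal.ofReal (1 / ((n:ℝ) + 1)))^(1/d)) Filter.atTop (nhds 0) := by
    have := hlim.ennrpow_const (1/d)
    rwa [ENNReal.zero_rpow_of_pos (by positivity)] at this
  have := Measure.hausdorffMeasure_le_liminf_tsum d S _ hr t ?_ (Filter.Eventually.of_forall ht1)
  · refine le_antisymm (this.trans ?_) zero_le
    rw [← hlim.liminf_eq]
    exact Filter.liminf_le_liminf (Filter.Eventually.of_forall ht2)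
  · refine Filter.Eventually.of_forall (fun n i => ?_)
    rw [one_div d, ENNReal.le_rpow_inv_iff hd]
    exact (ENNReal.le_tsum i).trans (ht2 n)

/-- index of the dyadic cube containing a point -/
def idx (k : ℕ) (z : Plane) : Fin 2 → ℤ := fun i => ⌊z i * 2^k⌋

lemma mem_cube (k : ℕ) (m : Fin 2 → ℤ) (z : Plane) : z ∈ dyadicCube 2 k m ↔ idx k z = m := by
  have h2 : (0:ℝ) < 2^k := by positivity
  rw [funext_iff]
  simp only [dyadicCube, mem_ofPred_eq, idx, Int.floor_eq_iff, zpow_neg, zpow_natCast]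
  refine forall_congr' (fun i => ?_)
  rw [← div_eq_mul_inv, ← div_eq_mul_inv, div_le_iff₀ h2, lt_div_iff₀ h2]

lemma pts_eq (k : ℕ) (S : Set Plane) :
    {m : Fin 2 → ℤ | (dyadicCube 2 k m ∩ S).Nonempty} = idx k '' S := by
  ext m
  simp only [mem_ofPred_eq, Set.Nonempty, mem_inter_iff, mem_cube, mem_image]
  exact exists_congr (fun z => and_comm)

lemma covNum_eq (k : ℕ) (S : Set Plane) : covNum 2 k S = (idx k '' S).ncard := by
  rw [covNum, pts_eq]

lemma idx_le (k : ℕ) (z : Plane) (i : Fin 2) : (idx k z i : ℝ) ≤ z i * 2^k := Int.floor_le _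
lemma lt_idx (k : ℕ) (z : Plane) (i : Fin 2) : z i * 2^k < idx k z i + 1 := Int.lt_floor_add_one _

lemma coord_le (z : Plane) (i : Fin 2) : |z i| ≤ ‖z‖ := by
  have := PiLp.norm_apply_le z i
  simpa using this

lemma idx_finite (k : ℕ) {S : Set Plane} (hS : Bornology.IsBounded S) : (idx k '' S).Finite := by
  obtain ⟨M, hM⟩ := hS.exists_norm_le
  refine (Set.finite_Icc (fun _ : Fin 2 => ⌊-M * 2^k⌋) (fun _ => ⌊M * 2^k⌋)).subset ?_
  rintro _ ⟨z, hz, rfl⟩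
  have := fun i => abs_le.mp ((coord_le z i).trans (hM z hz))
  constructor
  · intro i; apply Int.floor_le_floor; have := (this i).1; gcongr
  · intro i; apply Int.floor_le_floor; have := (this i).2; gcongr

lemma dist_le_coord (x y : Plane) (r : ℝ) (hr : 0 ≤ r) (h : ∀ i, |x i - y i| ≤ r) : dist x y ≤ 2 * r := by
  rw [EuclideanSpace.dist_eq]
  apply Real.sqrt_le_iff.mpr
  refine ⟨by positivity, ?_⟩
  rw [Fin.sum_univ_two]
  simp only [Real.dist_eq, sq_abs]
  have h0 := sq_le_sq' (abs_le.mp (h 0)).1 (abs_le.mp (h 0)).2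
  have h1 := sq_le_sq' (abs_le.mp (h 1)).1 (abs_le.mp (h 1)).2
  nlinarith

lemma cube_ediam (k : ℕ) (m : Fin 2 → ℤ) : ediam (dyadicCube 2 k m) ≤ ENNReal.ofReal (2 * ((2:ℝ)^k)⁻¹) := by
  apply ediam_le
  intro x hx y hy
  rw [edist_dist]
  apply ENNReal.ofReal_le_ofReal
  apply dist_le_coord _ _ _ (by positivity)
  intro i
  rw [mem_cube] at hx hy
  have h2 : (0:ℝ) < 2^k := by positivity
  have a1 := idx_le k x i
  have a2 := lt_idx k x i
  have a3 := idx_le k y i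
  have a4 := lt_idx k y i
  rw [hx] at a1 a2
  rw [hy] at a3 a4
  rw [← one_div, le_div_iff₀ h2, ← abs_of_pos h2, ← abs_mul, abs_le]
  constructor <;> nlinarith

lemma cube_ediam_rpow (k : ℕ) (m : Fin 2 → ℤ) (d : ℝ) (hd : 0 ≤ d) : 
    ediam (dyadicCube 2 k m) ^ d ≤ ENNReal.ofReal (2^d * (2:ℝ)^(-(k * d))) := by
  refine (ENNReal.rpow_le_rpow (cube_ediam k m) hd).trans ?_
  rw [ENNReal.ofReal_rpow_of_nonneg (by positivity) hd]
  apply ENNReal.ofReal_le_ofReal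
  rw [Real.mul_rpow (by norm_num) (by positivity), ← Real.rpow_natCast, ← Real.rpow_neg (by norm_num),
    ← Real.rpow_mul (by norm_num), neg_mul]

lemma dim_le_of_cov {S : Set Plane} (hS : Bornology.IsBounded S) (b : ℝ) (hb : 0 ≤ b)
    (h : ∃ᶠ k : ℕ in Filter.atTop, (covNum 2 k S : ℝ) ≤ (2:ℝ)^(k * b)) :
    dimH S ≤ ENNReal.ofReal b := by
  classical
  have key : ∀ b' : ℝ, b < b' → dimH S ≤ ENNReal.ofReal b' := by
    intro b' hb'
    have hb0 : 0 < b' := by linarith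
    have hz : μH[b'] S = 0 := by
      apply content_zero (β := Fin 2 → ℤ) b' hb0
      intro δ hδ
      have hlim : Filter.Tendsto (fun k : ℕ => 2^b' * ((2:ℝ)^(b - b'))^k) Filter.atTop (nhds (2^b' * 0)) := by
        apply Filter.Tendsto.const_mul
        apply tendsto_pow_atTop_nhds_zero_of_lt_one (by positivity)
        exact Real.rpow_lt_one_of_one_lt_of_neg (by norm_num) (by linarith)
      rw [mul_zero] at hlim
      obtain ⟨k, hk1, hk2⟩ := (h.and_eventually (hlim.eventually_le_const hδ)).exists
      have hfin := idx_finite k hS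
      refine ⟨fun m => if m ∈ idx k '' S then dyadicCube 2 k m else ∅, ?_, ?_⟩
      · intro z hz
        refine mem_iUnion.mpr ⟨idx k z, ?_⟩
        rw [if_pos (mem_image_of_mem _ hz), mem_cube]
      · rw [tsum_eq_sum (s := hfin.toFinset)]
        · calc _ ≤ ∑ m ∈ hfin.toFinset, ENNReal.ofReal (2^b' * (2:ℝ)^(-(k * b'))) := by
                apply Finset.sum_le_sum
                intro m hm
                beta_reduce
                rw [if_pos (hfin.mem_toFinset.mp hm)]
                exact cube_ediam_rpow k m b' hb0.le
            _ = ENNReal.ofReal (covNum 2 k S * (2^b' * (2:ℝ)^(-(k * b')))) := by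
                rw [Finset.sum_const, nsmul_eq_mul, covNum_eq, Set.ncard_eq_toFinset_card _ hfin,
                  ENNReal.ofReal_mul (Nat.cast_nonneg _), ENNReal.ofReal_natCast]
            _ ≤ _ := by
                apply ENNReal.ofReal_le_ofReal
                refine le_trans ?_ hk2
                calc _ ≤ (2:ℝ)^(k*b) * (2^b' * (2:ℝ)^(-(k * b'))) := by gcongr
                  _ = 2^b' * ((2:ℝ)^(k*b) * (2:ℝ)^(-(k * b'))) := by ring
                  _ = _ := by
                    rw [← Real.rpow_add (by norm_num), ← Real.rpow_natCast, ← Real.rpow_mul (by norm_num)]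
                    congr 2; ring
        · intro m hm
          beta_reduce
          rw [if_neg (fun hm' => hm (hfin.mem_toFinset.mpr hm'))]
          simp [hb0]
    have := dimH_le_of_hausdorffMeasure_ne_top (s := S) (d := ⟨b', hb0.le⟩) (by
      change μH[b'] S ≠ ∞
      rw [hz]; simp)
    refine this.trans (le_of_eq ?_)
    rw [ENNReal.ofReal, Real.toNNReal_of_nonneg hb0.le]; rfl
  have hl : Filter.Tendsto (fun n : ℕ => ENNReal.ofReal (b + 1 / ((n:ℝ) + 1))) Filter.atTop
      (nhds (ENNReal.ofReal (b + 0))) :=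
    ENNReal.tendsto_ofReal (tendsto_const_nhds.add tendsto_one_div_add_atTop_nhds_zero_nat)
  rw [add_zero] at hl
  refine ge_of_tendsto' hl (fun n => key _ ?_)
  have : (0:ℝ) < 1 / ((n:ℝ) + 1) := by positivity
  linarith

lemma scale_choice (a : ℝ) (ha : 0 < a) (k0 : ℕ) (x : ℝ) (hx0 : 0 ≤ x) (hx : x ≤ ((2:ℝ)^k0)⁻¹)
    (τ : ℝ) (hτ : 0 < τ) :
    ∃ k : ℕ, k0 ≤ k ∧ x ≤ ((2:ℝ)^k)⁻¹ ∧ (2:ℝ)^(-(k * a)) ≤ 2^a * x^a + τ := by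
  rcases hx0.eq_or_lt with h | h
  · subst h
    have hlim : Filter.Tendsto (fun k : ℕ => ((2:ℝ)^(-a))^k) Filter.atTop (nhds 0) := by
      apply tendsto_pow_atTop_nhds_zero_of_lt_one (by positivity)
      exact Real.rpow_lt_one_of_one_lt_of_neg (by norm_num) (by linarith)
    obtain ⟨k, hk1, hk2⟩ := ((hlim.eventually_le_const hτ).and (Filter.eventually_ge_atTop k0)).exists
    refine ⟨k, hk2, by positivity, ?_⟩
    rw [Real.zero_rpow ha.ne', mul_zero, zero_add]
    refine le_trans (le_of_eq ?_) hk1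
    rw [← Real.rpow_natCast, ← Real.rpow_mul (by norm_num)]
    congr 1; ring
  · have hx' : (2:ℝ)^k0 ≤ x⁻¹ := by
      rw [le_inv_comm₀ (by positivity) h]; exact hx
    obtain ⟨n, hn1, hn2⟩ := exists_nat_pow_near ((one_le_pow₀ (by norm_num)).trans hx') (by norm_num : (1:ℝ) < 2)
    refine ⟨n, ?_, ?_, ?_⟩
    · have := (pow_lt_pow_iff_right₀ (by norm_num : (1:ℝ) < 2)).mp (hx'.trans_lt hn2)
      omega
    · rw [le_inv_comm₀ h (by positivity)]; exact hn1
    · have h1 : ((2:ℝ)^(n+1))⁻¹ ≤ x := by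
        rw [inv_le_comm₀ (by positivity) h]; exact hn2.le
      have h2 : (((2:ℝ)^(n+1))⁻¹)^a ≤ x^a := Real.rpow_le_rpow (by positivity) h1 ha.le
      have h3 : (2:ℝ)^(-(n * a)) = 2^a * (((2:ℝ)^(n+1))⁻¹)^a := by
        rw [← Real.rpow_natCast, ← Real.rpow_neg (by norm_num), ← Real.rpow_mul (by norm_num),
          ← Real.rpow_add (by norm_num)]
        congr 1; push_cast; ring
      rw [h3]
      have : 2^a * (((2:ℝ)^(n+1))⁻¹)^a ≤ 2^a * x^a := by gcongr
      linarith

lemma close_card (k : ℕ) (S : Set Plane) 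
    (h : ∀ x ∈ S, ∀ y ∈ S, dist x y ≤ 3 * ((2:ℝ)^k)⁻¹) : (idx k '' S).ncard ≤ 81 := by
  rcases S.eq_empty_or_nonempty with hS | ⟨x, hx⟩
  · simp [hS]
  have hsub : idx k '' S ⊆ (Finset.Icc (fun i => idx k x i - 4) (fun i => idx k x i + 4) : Finset (Fin 2 → ℤ)) := by
    rintro _ ⟨y, hy, rfl⟩
    have h2 : (0:ℝ) < 2^k := by positivity
    have key : ∀ i, idx k x i - 4 ≤ idx k y i ∧ idx k y i ≤ idx k x i + 4 := by
      intro i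
      have h1 : |(x - y) i| ≤ 3 * ((2:ℝ)^k)⁻¹ := by
        refine (coord_le _ i).trans ?_
        rw [← dist_eq_norm]; exact h x hx y hy
      rw [PiLp.sub_apply, ← div_eq_mul_inv, le_div_iff₀ h2, ← abs_of_pos h2, ← abs_mul, abs_le] at h1
      have a1 := idx_le k x i
      have a2 := lt_idx k x i
      have a3 := idx_le k y i
      have a4 := lt_idx k y i
      constructor
      · have : ((idx k x i - 4 : ℤ) : ℝ) ≤ (idx k y i : ℝ) := by push_cast; linarith [h1.2]
        exact_mod_cast this
      · have : (idx k y i : ℝ) ≤ ((idx k x i + 4 : ℤ) : ℝ) := by push_cast; linarith [h1.1]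
        exact_mod_cast this
    rw [Finset.coe_Icc]
    exact ⟨fun i => (key i).1, fun i => (key i).2⟩
  refine (Set.ncard_le_ncard hsub (Finset.finite_toSet _)).trans ?_
  rw [Set.ncard_coe_finset, Pi.card_Icc, Fin.prod_univ_two, Int.card_Icc, Int.card_Icc]
  have e : ∀ a : ℤ, (a + 4 + 1 - (a - 4)).toNat = 9 := by intro a; omega
  rw [e, e]; norm_num

lemma mass_lower {K : Set Plane} (hK : IsCompact K) (hne : K.Nonempty) (C : ℝ) (hC : 0 < C)
    (hsub : ∀ j k : ℕ, j ≤ k → ∀ m : Fin 2 → ℤ, (dyadicCube 2 j m ∩ K).Nonempty →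
    (covNum 2 j K : ℝ) * (covNum 2 k (K ∩ dyadicCube 2 j m) : ℝ) ≤ C * (covNum 2 k K : ℝ))
    (a : ℝ) (ha : 0 < a) (k0 : ℕ) (hk0 : ∀ k ≥ k0, (2:ℝ)^(k * a) ≤ covNum 2 k K) :
    μH[a] K ≠ 0 := by
  classical
  intro hz
  have hb := hK.isBounded
  obtain ⟨δ, hδ0, hδ⟩ : ∃ δ : ℝ, 0 < δ ∧ 81 * C * (2^a * δ + 2 * δ) < 1 := by
    have hp : (0:ℝ) < 81 * C * (2^a + 2) := by positivity
    refine ⟨(81 * C * (2^a + 2))⁻¹ / 2, by positivity, ?_⟩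
    have : 81 * C * (2^a * ((81 * C * (2^a + 2))⁻¹ / 2) + 2 * ((81 * C * (2^a + 2))⁻¹ / 2)) 
      = (81 * C * (2^a + 2)) * (81 * C * (2^a + 2))⁻¹ / 2 := by ring
    rw [this, mul_inv_cancel₀ hp.ne']; norm_num
  obtain ⟨t, hcov, hdiam, hsum⟩ : ∃ t : ℕ → Set Plane, K ⊆ ⋃ i, t i ∧ 
      (∀ i, ediam (t i) ≤ ENNReal.ofReal ((2:ℝ)^k0)⁻¹) ∧ 
      ∑' i, ⨆ (_ : (t i).Nonempty), ediam (t i)^a < ENNReal.ofReal δ := by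
    rw [Measure.hausdorffMeasure_apply] at hz
    have h1 := (ENNReal.iSup_eq_zero.mp hz) (ENNReal.ofReal ((2:ℝ)^k0)⁻¹)
    have h2 := (ENNReal.iSup_eq_zero.mp h1) (by rw [ENNReal.ofReal_pos]; positivity)
    have h3 : _ < ENNReal.ofReal δ := h2.trans_lt (by rwa [ENNReal.ofReal_pos])
    simp only [iInf_lt_iff] at h3
    obtain ⟨t, h4, h5, h6⟩ := h3
    exact ⟨t, h4, h5, h6⟩
  have hfin : ∀ i, ediam (t i) ≠ ∞ := fun i => ne_top_of_le_ne_top ENNReal.ofReal_ne_top (hdiam i)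
  let x : ℕ → ℝ := fun i => (ediam (t i)).toReal
  have hx0 : ∀ i, 0 ≤ x i := fun i => ENNReal.toReal_nonneg
  have hx : ∀ i, x i ≤ ((2:ℝ)^k0)⁻¹ := fun i => ENNReal.toReal_le_of_le_ofReal (by positivity) (hdiam i)
  choose kk hkk1 hkk2 hkk3 using fun i => scale_choice a ha k0 (x i) (hx0 i) (hx i) (δ * (1/2)^i) (by positivity)
  have hr : ∀ i, (0:ℝ) < ((2:ℝ)^(kk i))⁻¹ := fun i => by positivity
  obtain ⟨I, hI⟩ := hK.elim_finite_subcover (fun i => thickening ((2:ℝ)^(kk i))⁻¹ (t i))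
    (fun i => isOpen_thickening) (hcov.trans (iUnion_mono fun i => self_subset_thickening (hr i) _))
  let U : ℕ → Set Plane := fun i => K ∩ thickening ((2:ℝ)^(kk i))⁻¹ (t i)
  have hUb : ∀ i, Bornology.IsBounded (U i) := fun i => hb.subset inter_subset_left
  let V : ℕ → Finset (Fin 2 → ℤ) := fun i => (idx_finite (kk i) (hUb i)).toFinset
  have hV : ∀ i, (V i).card ≤ 81 := by
    intro i
    rw [← Set.ncard_eq_toFinset_card _ (idx_finite (kk i) (hUb i))]
    apply close_card
    rintro y ⟨-, hy⟩ z ⟨-, hz⟩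
    obtain ⟨y', hy', hyd⟩ := mem_thickening_iff.mp hy
    obtain ⟨z', hz', hzd⟩ := mem_thickening_iff.mp hz
    have h1 : dist y' z' ≤ x i := by
      rw [dist_edist]
      exact ENNReal.toReal_mono (hfin i) (edist_le_ediam_of_mem hy' hz')
    have h2 := hkk2 i
    have h3 := dist_triangle4 y y' z' z
    rw [dist_comm z' z] at h3
    linarith
  let k := I.sup kk
  have hkb : ∀ i ∈ I, kk i ≤ k := fun i hi => Finset.le_sup hi
  have hKf := idx_finite k hb
  let W : (i : ℕ) → (Fin 2 → ℤ) → Finset (Fin 2 → ℤ) := fun i M =>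
    (idx_finite k (hb.subset (inter_subset_left (t := dyadicCube 2 (kk i) M)))).toFinset
  have hsubset : hKf.toFinset ⊆ I.biUnion (fun i => (V i).biUnion (W i)) := by
    intro m hm
    obtain ⟨y, hy, rfl⟩ := hKf.mem_toFinset.mp hm
    obtain ⟨i, hi, hyi⟩ := mem_iUnion₂.mp (hI hy)
    rw [Finset.mem_biUnion]
    refine ⟨i, hi, ?_⟩
    rw [Finset.mem_biUnion]
    refine ⟨idx (kk i) y, ?_, ?_⟩
    · simp only [V, Set.Finite.mem_toFinset]
      exact ⟨y, ⟨hy, hyi⟩, rfl⟩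
    · simp only [W, Set.Finite.mem_toFinset]
      exact ⟨y, ⟨hy, (mem_cube _ _ _).mpr rfl⟩, rfl⟩
  have hnk : (covNum 2 k K : ℝ) = (hKf.toFinset.card : ℝ) := by
    rw [covNum_eq, Set.ncard_eq_toFinset_card _ hKf]
  have hnpos : (0:ℝ) < covNum 2 k K := by
    rw [hnk]; norm_cast
    rw [Finset.card_pos, Set.Finite.toFinset_nonempty]
    exact hne.image _
  have hW : ∀ i ∈ I, ∀ M ∈ V i, ((W i M).card : ℝ) ≤ C * covNum 2 k K * (2:ℝ)^(-(kk i * a)) := by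
    intro i hi M hM
    have hM' : (dyadicCube 2 (kk i) M ∩ K).Nonempty := by
      obtain ⟨y, hy, rfl⟩ := (Set.Finite.mem_toFinset _).mp hM
      exact ⟨y, (mem_cube _ _ _).mpr rfl, hy.1⟩
    have h1 := hsub (kk i) k (hkb i hi) M hM'
    have h2 : ((W i M).card : ℝ) = covNum 2 k (K ∩ dyadicCube 2 (kk i) M) := by
      rw [covNum_eq, Set.ncard_eq_toFinset_card _
        (idx_finite k (hb.subset (inter_subset_left (t := dyadicCube 2 (kk i) M))))]
    rw [h2, Real.rpow_neg (by norm_num), ← div_eq_mul_inv, le_div_iff₀ (by positivity), mul_comm]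
    refine le_trans ?_ h1
    gcongr
    exact hk0 _ (hkk1 i)
  have hcount : (covNum 2 k K : ℝ) ≤ ∑ i ∈ I, 81 * (C * covNum 2 k K * (2:ℝ)^(-(kk i * a))) := by
    calc (covNum 2 k K : ℝ) = (hKf.toFinset.card : ℝ) := hnk
      _ ≤ ((I.biUnion (fun i => (V i).biUnion (W i))).card : ℝ) := by
        exact_mod_cast Finset.card_le_card hsubset
      _ ≤ ∑ i ∈ I, (((V i).biUnion (W i)).card : ℝ) := by exact_mod_cast Finset.card_biUnion_le
      _ ≤ _ := by
        apply Finset.sum_le_sum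
        intro i hi
        calc (((V i).biUnion (W i)).card : ℝ) ≤ ∑ M ∈ V i, ((W i M).card : ℝ) := by
              exact_mod_cast Finset.card_biUnion_le
          _ ≤ ∑ M ∈ V i, C * covNum 2 k K * (2:ℝ)^(-(kk i * a)) := Finset.sum_le_sum (hW i hi)
          _ = (V i).card * (C * covNum 2 k K * (2:ℝ)^(-(kk i * a))) := by
              rw [Finset.sum_const, nsmul_eq_mul]
          _ ≤ _ := by
              gcongr
              exact_mod_cast hV i
  have hs1 : ∑ i ∈ I, x i ^ a ≤ δ := by
    rw [← ENNReal.ofReal_le_ofReal_iff hδ0.le, ENNReal.ofReal_sum_of_nonneg (fun i _ => by have := hx0 i; positivity)]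
    refine le_trans ?_ hsum.le
    refine le_trans (Finset.sum_le_sum (fun i _ => ?_)) (ENNReal.sum_le_tsum I)
    rw [← ENNReal.ofReal_rpow_of_nonneg (hx0 i) ha.le]
    simp only [x]
    rw [ENNReal.ofReal_toReal (hfin i)]
    rcases (t i).eq_empty_or_nonempty with h | h
    · simp [h, ha]
    · exact le_iSup (fun _ : (t i).Nonempty => ediam (t i)^a) h
  have hs2 : ∑ i ∈ I, δ * (1/2:ℝ)^i ≤ 2 * δ := by
    rw [← Finset.mul_sum, mul_comm]
    gcongr
    have := Summable.sum_le_tsum I (fun i _ => by positivity) summable_geometric_two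
    rwa [tsum_geometric_two] at this
  have hs3 : ∑ i ∈ I, (2:ℝ)^(-(kk i * a)) ≤ 2^a * δ + 2 * δ := by
    calc _ ≤ ∑ i ∈ I, (2^a * x i^a + δ * (1/2:ℝ)^i) := Finset.sum_le_sum (fun i _ => hkk3 i)
      _ = 2^a * ∑ i ∈ I, x i^a + ∑ i ∈ I, δ * (1/2:ℝ)^i := by
        rw [Finset.sum_add_distrib, Finset.mul_sum]
      _ ≤ _ := by gcongr
  have e : ∑ i ∈ I, 81 * (C * covNum 2 k K * (2:ℝ)^(-(kk i * a))) 
      = covNum 2 k K * (81 * C * ∑ i ∈ I, (2:ℝ)^(-(kk i * a))) := by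
    rw [Finset.mul_sum, Finset.mul_sum]
    exact Finset.sum_congr rfl (fun i _ => by ring)
  rw [e] at hcount
  have h5 : 81 * C * ∑ i ∈ I, (2:ℝ)^(-(kk i * a)) < 1 := by
    refine lt_of_le_of_lt ?_ hδ
    gcongr
  have h6 := mul_lt_mul_of_pos_left h5 hnpos
  linarith

lemma freq_small {K : Set Plane} (hK : IsCompact K) (hne : K.Nonempty) (C : ℝ) (hC : 0 < C)
    (hsub : ∀ j k : ℕ, j ≤ k → ∀ m : Fin 2 → ℤ, (dyadicCube 2 j m ∩ K).Nonempty →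
    (covNum 2 j K : ℝ) * (covNum 2 k (K ∩ dyadicCube 2 j m) : ℝ) ≤ C * (covNum 2 k K : ℝ))
    (a : ℝ) (ha : 0 < a) (hdim : dimH K < ENNReal.ofReal a) : 
    ∃ᶠ k : ℕ in Filter.atTop, (covNum 2 k K : ℝ) < (2:ℝ)^(k * a) := by
  intro hcon
  simp only [not_lt, Filter.eventually_atTop] at hcon
  obtain ⟨k0, hk0⟩ := hcon
  have h1 := mass_lower hK hne C hC hsub a ha k0 hk0
  have h2 := le_dimH_of_hausdorffMeasure_ne_zero (s := K) (d := a.toNNReal) (by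
    rwa [Real.coe_toNNReal a ha.le])
  exact absurd hdim (not_lt.mpr h2)

/-- projection of points -/
def pp (θ : ℝ) (z : Plane) : ℝ := Real.cos θ * z 1 - Real.sin θ * z 0

lemma prj_idx (θ : ℝ) (k : ℕ) (z : Plane) : |prj θ (idx k z) - 2^k * pp θ z| ≤ 2 := by
  unfold prj pp
  have e : Real.cos θ * (idx k z 1 : ℝ) - Real.sin θ * (idx k z 0 : ℝ) -
    2^k * (Real.cos θ * z 1 - Real.sin θ * z 0) =
    Real.cos θ * ((idx k z 1 : ℝ) - z 1 * 2^k) - Real.sin θ * ((idx k z 0 : ℝ) - z 0 * 2^k) := by ring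
  rw [e]
  have a1 := idx_le k z 0
  have a2 := lt_idx k z 0
  have a3 := idx_le k z 1
  have a4 := lt_idx k z 1
  have b0 : |(idx k z 0 : ℝ) - z 0 * 2^k| ≤ 1 := by rw [abs_le]; constructor <;> linarith
  have b1 : |(idx k z 1 : ℝ) - z 1 * 2^k| ≤ 1 := by rw [abs_le]; constructor <;> linarith
  refine (abs_sub _ _).trans ?_
  rw [abs_mul, abs_mul]
  have c1 := mul_le_one₀ (Real.abs_cos_le_one θ) (abs_nonneg _) b1
  have c2 := mul_le_one₀ (Real.abs_sin_le_one θ) (abs_nonneg _) b0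
  linarith

/-- cube indices meeting `K`, as a finset -/
def PP {K : Set Plane} (hb : Bornology.IsBounded K) (k : ℕ) : Finset (Fin 2 → ℤ) :=
  (idx_finite k hb).toFinset

lemma mem_PP {K : Set Plane} (hb : Bornology.IsBounded K) (k : ℕ) (m : Fin 2 → ℤ) :
    m ∈ PP hb k ↔ ∃ z ∈ K, idx k z = m := by
  simp [PP]

lemma card_PP {K : Set Plane} (hb : Bornology.IsBounded K) (k : ℕ) : (PP hb k).card = covNum 2 k K := by
  rw [covNum_eq, Set.ncard_eq_toFinset_card _ (idx_finite k hb)]; rfl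

/-- indices in the tube around z -/
def tube {K : Set Plane} (hb : Bornology.IsBounded K) (θ : ℝ) (k : ℕ) (z : Plane) : Finset (Fin 2 → ℤ) :=
  open Classical in (PP hb k).filter (fun m => |prj θ m - 2^k * pp θ z| ≤ 4)

lemma mem_tube {K : Set Plane} (hb : Bornology.IsBounded K) (θ : ℝ) (k : ℕ) (z : Plane) (m : Fin 2 → ℤ) :
    m ∈ tube hb θ k z ↔ m ∈ PP hb k ∧ |prj θ m - 2^k * pp θ z| ≤ 4 := by
  simp [tube]

lemma tube_card_le {K : Set Plane} (hb : Bornology.IsBounded K) (θ : ℝ) (k : ℕ) (z : Plane) :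
    (tube hb θ k z).card ≤ (PP hb k).card := Finset.card_le_card (Finset.filter_subset _ _)

/-- the defining property of good heavy cubes -/
def Good (A lam : ℝ) (P : Finset (Fin 2 → ℤ)) (θ : ℝ) (m : Fin 2 → ℤ) : Prop :=
  ∀ u, |prj θ m - u| ≤ 1 → lam ≤ ∑ m' ∈ P, chi ((prj θ m' - u)/7) ∧ 
      A⁻¹ * ∑ m' ∈ P, chi ((prj θ m' - u)/(7*A)) ≤ lam / 2

lemma heavy_good {K : Set Plane} (hb : Bornology.IsBounded K) (C : ℝ) (hC : 0 < C)
    (hsub : ∀ j k : ℕ, j ≤ k → ∀ m : Fin 2 → ℤ, (dyadicCube 2 j m ∩ K).Nonempty →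
    (covNum 2 j K : ℝ) * (covNum 2 k (K ∩ dyadicCube 2 j m) : ℝ) ≤ C * (covNum 2 k K : ℝ))
    (η : ℝ) (q : ℕ) (hq : 16 * C * (2:ℝ)^(-(((q + 4 : ℕ):ℝ) * η)) ≤ 1/2) (L : ℝ) (hL : 0 < L)
    (θ : ℝ) (z : Plane) (hz : z ∈ K) (k : ℕ) (hk : q + 4 ≤ k)
    (h1 : L * (2:ℝ)^((k:ℝ) * (η - 1)) * (PP hb k).card ≤ (tube hb θ k z).card)
    (h2 : (tube hb θ (k - (q+4)) z).card ≤ 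
      L * (2:ℝ)^(((k - (q+4) : ℕ):ℝ) * (η - 1)) * (PP hb (k - (q+4))).card) :
    Good (2^q) (L * (2:ℝ)^((k:ℝ) * (η - 1)) * (PP hb k).card) (PP hb k) θ (idx k z) := by
  classical
  intro u hu
  have hzu : |2^k * pp θ z - u| ≤ 3 := by
    have h3 := prj_idx θ k z
    rw [abs_le] at *
    constructor <;> linarith [h3.1, h3.2, hu.1, hu.2]
  constructor
  · refine h1.trans ?_
    calc ((tube hb θ k z).card : ℝ) = ∑ m' ∈ tube hb θ k z, (1:ℝ) := by simp
      _ ≤ ∑ m' ∈ tube hb θ k z, chi ((prj θ m' - u)/7) := by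
        apply Finset.sum_le_sum
        intro m' hm'
        rw [mem_tube] at hm'
        rw [chi_eq_one]
        rw [abs_div, abs_of_pos (by norm_num : (0:ℝ) < 7), div_le_one (by norm_num)]
        have h4 := hm'.2
        rw [abs_le] at *
        constructor <;> linarith [h4.1, h4.2, hzu.1, hzu.2]
      _ ≤ _ := Finset.sum_le_sum_of_subset_of_nonneg (Finset.filter_subset _ _) (fun i _ _ => chi_nonneg _)
  · set A : ℝ := 2^q with hA
    have hA1 : 1 ≤ A := one_le_pow₀ (by norm_num)
    have hA0 : 0 < A := by linarith
    obtain ⟨j, rfl⟩ : ∃ j, k = j + (q + 4) := ⟨k - (q+4), by omega⟩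
    have ej : j + (q+4) - (q+4) = j := by omega
    rw [ej] at h2
    set k := j + (q + 4) with hkdef
    let G := (PP hb k).filter (fun m' => |prj θ m' - u| ≤ 14 * A)
    have s1 : ∑ m' ∈ PP hb k, chi ((prj θ m' - u)/(7*A)) ≤ G.card := by
      have : ((G.card : ℕ) : ℝ) = ∑ m' ∈ PP hb k, if |prj θ m' - u| ≤ 14 * A then (1:ℝ) else 0 := by
        simp [G]
      rw [this]
      apply Finset.sum_le_sum
      intro m' _
      split_ifs with hif
      · exact chi_le_one _
      · rw [chi_eq_zero]
        rw [abs_div, abs_of_pos (by positivity : 0 < 7 * A), lt_div_iff₀ (by positivity)]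
        push Not at hif; linarith
    let W : (Fin 2 → ℤ) → Finset (Fin 2 → ℤ) := fun M =>
      (idx_finite k (hb.subset (inter_subset_left (t := dyadicCube 2 j M)))).toFinset
    have s2 : G ⊆ (tube hb θ j z).biUnion W := by
      intro m' hm'
      obtain ⟨hm1, hm2⟩ := Finset.mem_filter.mp hm'
      obtain ⟨y, hy, rfl⟩ := (mem_PP hb k m').mp hm1
      rw [Finset.mem_biUnion]
      refine ⟨idx j y, ?_, ?_⟩
      · rw [mem_tube, mem_PP]
        refine ⟨⟨y, hy, rfl⟩, ?_⟩
        have h3 := prj_idx θ k y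
        have h4 := prj_idx θ j y
        have e2 : (2:ℝ)^k = 16 * A * 2^j := by rw [hkdef, hA, pow_add, pow_add]; ring
        rw [e2] at h3 hzu
        have h5 : |16 * A * (2^j * pp θ y - 2^j * pp θ z)| ≤ 16 * A * 2 := by
          rw [abs_le] at *
          constructor <;> linarith [h3.1, h3.2, hzu.1, hzu.2, hm2.1, hm2.2]
        rw [abs_mul, abs_of_pos (by positivity : 0 < 16 * A)] at h5
        have h6 := le_of_mul_le_mul_left h5 (by positivity)
        rw [abs_le] at *
        constructor <;> linarith [h4.1, h4.2, h6.1, h6.2]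
      · simp only [W, Set.Finite.mem_toFinset]
        exact ⟨y, ⟨hy, (mem_cube _ _ _).mpr rfl⟩, rfl⟩
    have hnj : (0:ℝ) < (PP hb j).card := by
      norm_cast; rw [Finset.card_pos]
      exact ⟨idx j z, (mem_PP hb j _).mpr ⟨z, hz, rfl⟩⟩
    have s3 : ∀ M ∈ tube hb θ j z, ((W M).card : ℝ) ≤ C * (PP hb k).card / (PP hb j).card := by
      intro M hM
      obtain ⟨y, hy, rfl⟩ := (mem_PP hb j M).mp ((mem_tube hb θ j z M).mp hM).1
      have := hsub j k (by omega) (idx j y) ⟨y, (mem_cube _ _ _).mpr rfl, hy⟩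
      rw [le_div_iff₀ hnj, card_PP, card_PP]
      rw [mul_comm]
      refine le_trans (le_of_eq ?_) this
      rw [covNum_eq k (K ∩ _), Set.ncard_eq_toFinset_card _
        (idx_finite k (hb.subset (inter_subset_left (t := dyadicCube 2 j (idx j y)))))]
    have s4 : (G.card : ℝ) ≤ (tube hb θ j z).card * (C * (PP hb k).card / (PP hb j).card) := by
      calc (G.card : ℝ) ≤ (((tube hb θ j z).biUnion W).card : ℝ) := by exact_mod_cast Finset.card_le_card s2
        _ ≤ ∑ M ∈ tube hb θ j z, ((W M).card : ℝ) := by exact_mod_cast Finset.card_biUnion_le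
        _ ≤ ∑ M ∈ tube hb θ j z, (C * (PP hb k).card / (PP hb j).card) := Finset.sum_le_sum s3
        _ = _ := by rw [Finset.sum_const, nsmul_eq_mul]
    have s5 : (G.card : ℝ) ≤ L * (2:ℝ)^((j:ℝ) * (η - 1)) * (C * (PP hb k).card) := by
      refine s4.trans ?_
      calc _ ≤ (L * (2:ℝ)^((j:ℝ) * (η - 1)) * (PP hb j).card) * (C * (PP hb k).card / (PP hb j).card) := by
            gcongr
        _ = _ := by field_simp
    have e3 : A⁻¹ * (2:ℝ)^((j:ℝ) * (η - 1)) = 16 * (2:ℝ)^(-(((q + 4 : ℕ):ℝ) * η)) * (2:ℝ)^((k:ℝ) * (η - 1)) := by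
      have e16 : (16:ℝ) = (2:ℝ)^(4:ℝ) := by norm_num
      rw [hA, e16, ← Real.rpow_natCast, ← Real.rpow_neg (by norm_num), ← Real.rpow_add (by norm_num),
        ← Real.rpow_add (by norm_num), ← Real.rpow_add (by norm_num), hkdef]
      congr 1; push_cast; ring
    calc A⁻¹ * ∑ m' ∈ PP hb k, chi ((prj θ m' - u)/(7*A)) 
        ≤ A⁻¹ * (L * (2:ℝ)^((j:ℝ) * (η - 1)) * (C * (PP hb k).card)) := by
          gcongr; exact s1.trans s5
      _ = (A⁻¹ * (2:ℝ)^((j:ℝ) * (η - 1))) * (L * C * (PP hb k).card) := by ring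
      _ = (16 * C * (2:ℝ)^(-(((q + 4 : ℕ):ℝ) * η))) * (L * (2:ℝ)^((k:ℝ) * (η - 1)) * (PP hb k).card) := by
          rw [e3]; ring
      _ ≤ 1/2 * (L * (2:ℝ)^((k:ℝ) * (η - 1)) * (PP hb k).card) := by gcongr
      _ = _ := by ring

lemma exists_good {K : Set Plane} (hb : Bornology.IsBounded K) (C : ℝ) (hC : 0 < C)
    (hsub : ∀ j k : ℕ, j ≤ k → ∀ m : Fin 2 → ℤ, (dyadicCube 2 j m ∩ K).Nonempty →
    (covNum 2 j K : ℝ) * (covNum 2 k (K ∩ dyadicCube 2 j m) : ℝ) ≤ C * (covNum 2 k K : ℝ))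
    (η : ℝ) (hη : 0 < η) (q : ℕ) (hq : 16 * C * (2:ℝ)^(-(((q + 4 : ℕ):ℝ) * η)) ≤ 1/2) 
    (L : ℝ) (hL : 2^(q+4) < L)
    (θ : ℝ) (z : Plane) (hz : z ∈ K) 
    (h : ∃ k : ℕ, L * (2:ℝ)^((k:ℝ) * (η - 1)) * (PP hb k).card ≤ (tube hb θ k z).card) :
    ∃ k : ℕ, Good (2^q) (L * (2:ℝ)^((k:ℝ) * (η - 1)) * (PP hb k).card) (PP hb k) θ (idx k z) := by
  classical
  have hL0 : 0 < L := lt_trans (by positivity) hL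
  have h1 := Nat.find_spec h
  have hmin := fun j => Nat.find_min h (m := j)
  set k := Nat.find h
  have hn : (0:ℝ) < (PP hb k).card := by
    norm_cast; rw [Finset.card_pos]
    exact ⟨idx k z, (mem_PP hb k _).mpr ⟨z, hz, rfl⟩⟩
  have hk : q + 4 ≤ k := by
    by_contra hlt
    push Not at hlt
    have h2 : ((tube hb θ k z).card : ℝ) ≤ (PP hb k).card := by exact_mod_cast tube_card_le hb θ k z
    have h3 : (1:ℝ) < L * (2:ℝ)^((k:ℝ) * (η - 1)) := by
      have h4 : (2:ℝ)^(-((q+4:ℕ):ℝ)) ≤ (2:ℝ)^((k:ℝ) * (η - 1)) := by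
        apply Real.rpow_le_rpow_of_exponent_le (by norm_num)
        have : (k:ℝ) ≤ ((q+4:ℕ):ℝ) := by exact_mod_cast hlt.le
        have : 0 ≤ (k:ℝ) * η := by positivity
        nlinarith
      rw [Real.rpow_neg (by norm_num), Real.rpow_natCast] at h4
      calc (1:ℝ) = 2^(q+4) * (2^(q+4))⁻¹ := (mul_inv_cancel₀ (by positivity)).symm
        _ < L * (2^(q+4))⁻¹ := by gcongr
        _ ≤ _ := by gcongr
    have h5 := mul_lt_mul_of_pos_right h3 hn
    linarith
  refine ⟨k, heavy_good hb C hC hsub η q hq L hL0 θ z hz k hk h1 ?_⟩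
  exact (not_le.mp (hmin (k - (q+4)) (by omega))).le

lemma zero_meas {K : Set Plane} (hb : Bornology.IsBounded K) (hne : K.Nonempty) (C : ℝ) (hC : 0 < C)
    (hsub : ∀ j k : ℕ, j ≤ k → ∀ m : Fin 2 → ℤ, (dyadicCube 2 j m ∩ K).Nonempty →
    (covNum 2 j K : ℝ) * (covNum 2 k (K ∩ dyadicCube 2 j m) : ℝ) ≤ C * (covNum 2 k K : ℝ))
    (η : ℝ) (hη : 0 < η) (q : ℕ) (hq : 16 * C * (2:ℝ)^(-(((q + 4 : ℕ):ℝ) * η)) ≤ 1/2) 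
    (θ ε d D : ℝ) (hε : 0 < ε) (hd : 0 < d) (hdε : 1 - η + 2 * ε ≤ d) (hD : 0 < D)
    (hen : ∀ k : ℕ, energy (2^q) (PP hb k) (prj θ) ≤ D * ((PP hb k).card * (2:ℝ)^(k * ε)))
    (S : Set Plane) (hSK : S ⊆ K) 
    (hS : ∀ z ∈ S, ∀ L : ℝ, ∃ k : ℕ, L * (2:ℝ)^((k:ℝ) * (η - 1)) * (PP hb k).card ≤ (tube hb θ k z).card) :
    μH[d] S = 0 := by
  classical
  apply content_zero (β := ℕ × (Fin 2 → ℤ)) d hd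
  intro δ hδ
  set r : ℝ := (2:ℝ)^(-ε) with hr
  have hr0 : 0 < r := by positivity
  have hr1 : r < 1 := Real.rpow_lt_one_of_one_lt_of_neg (by norm_num) (by linarith)
  obtain ⟨L, hL1, hL2⟩ : ∃ L : ℝ, 2^(q+4) < L ∧ 2 * D * 2^d * (1-r)⁻¹ / L ≤ δ := by
    refine ⟨2^(q+4) + 1 + 2 * D * 2^d * (1-r)⁻¹ / δ, ?_, ?_⟩
    · have : 0 < 1 - r := by linarith
      have : 0 ≤ 2 * D * 2^d * (1-r)⁻¹ / δ := by positivity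
      linarith
    · have : 0 < 1 - r := by linarith
      rw [div_le_iff₀ (by positivity), mul_add, mul_div_cancel₀ _ hδ.ne']
      have : 0 ≤ δ * ((2:ℝ)^(q+4) + 1) := by positivity
      linarith
  have hL0 : 0 < L := lt_trans (by positivity) hL1
  have hn : ∀ k, (0:ℝ) < (PP hb k).card := by
    intro k
    obtain ⟨z, hz⟩ := hne
    norm_cast; rw [Finset.card_pos]
    exact ⟨idx k z, (mem_PP hb k _).mpr ⟨z, hz, rfl⟩⟩
  let lam : ℕ → ℝ := fun k => L * (2:ℝ)^((k:ℝ) * (η - 1)) * (PP hb k).card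
  have hlam : ∀ k, 0 < lam k := fun k => by have := hn k; positivity
  let F : ℕ → Finset (Fin 2 → ℤ) := fun k => (PP hb k).filter (fun m => Good (2^q) (lam k) (PP hb k) θ m)
  have hF : ∀ k, ((F k).card : ℝ) ≤ 2 * D / L * (2:ℝ)^((k:ℝ) * (ε + 1 - η)) := by
    intro k
    have h1 := count_bound (A := 2^q) (one_le_pow₀ (by norm_num)) (PP hb k) (F k) (Finset.filter_subset _ _)
      (prj θ) (lam k) (hlam k) (fun m hm => (Finset.mem_filter.mp hm).2)
    have h2 := hen k
    rw [← le_div_iff₀ (hlam k)] at h1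
    refine h1.trans ?_
    rw [div_le_iff₀ (hlam k)]
    have e : (2:ℝ)^((k:ℝ) * (ε + 1 - η)) * (2:ℝ)^((k:ℝ) * (η - 1)) = (2:ℝ)^(k * ε) := by
      rw [← Real.rpow_add (by norm_num)]; congr 1; ring
    calc 2 * energy (2^q) (PP hb k) (prj θ) ≤ 2 * (D * ((PP hb k).card * (2:ℝ)^(k * ε))) := by gcongr
      _ = 2 * D * (PP hb k).card * ((2:ℝ)^((k:ℝ) * (ε + 1 - η)) * (2:ℝ)^((k:ℝ) * (η - 1))) := by
        rw [e]; ring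
      _ = _ := by simp only [lam]; field_simp
  refine ⟨fun p => if p.2 ∈ F p.1 then dyadicCube 2 p.1 p.2 else ∅, ?_, ?_⟩
  · intro z hz
    obtain ⟨k, hk⟩ := exists_good hb C hC hsub η hη q hq L hL1 θ z (hSK hz) (hS z hz L)
    refine mem_iUnion.mpr ⟨(k, idx k z), ?_⟩
    rw [if_pos]
    · exact (mem_cube _ _ _).mpr rfl
    · exact Finset.mem_filter.mpr ⟨(mem_PP hb k _).mpr ⟨z, hSK hz, rfl⟩, hk⟩
  · refine (le_of_eq (ENNReal.tsum_prod
      (f := fun k m => ediam (if m ∈ F k then dyadicCube 2 k m else ∅) ^ d))).trans ?_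
    have hk : ∀ k : ℕ, ∑' m, ediam (if m ∈ F k then dyadicCube 2 k m else ∅) ^ d ≤ 
        ENNReal.ofReal (2 * D * 2^d / L * r^k) := by
      intro k
      rw [tsum_eq_sum (s := F k)]
      · calc _ ≤ ∑ m ∈ F k, ENNReal.ofReal (2^d * (2:ℝ)^(-(k * d))) := by
                apply Finset.sum_le_sum
                intro m hm
                rw [if_pos hm]
                exact cube_ediam_rpow k m d hd.le
          _ = ENNReal.ofReal ((F k).card * (2^d * (2:ℝ)^(-(k * d)))) := by
                rw [Finset.sum_const, nsmul_eq_mul, 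
                  ENNReal.ofReal_mul (Nat.cast_nonneg _), ENNReal.ofReal_natCast]
          _ ≤ _ := by
            apply ENNReal.ofReal_le_ofReal
            calc _ ≤ (2 * D / L * (2:ℝ)^((k:ℝ) * (ε + 1 - η))) * (2^d * (2:ℝ)^(-(k * d))) := by
                  gcongr; exact hF k
              _ = 2 * D * 2^d / L * ((2:ℝ)^((k:ℝ) * (ε + 1 - η)) * (2:ℝ)^(-(k * d))) := by ring
              _ ≤ _ := by
                gcongr
                rw [hr, ← Real.rpow_add (by norm_num), ← Real.rpow_natCast, ← Real.rpow_mul (by norm_num)]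
                apply Real.rpow_le_rpow_of_exponent_le (by norm_num)
                have : (k:ℝ) * (1 - η + 2 * ε) ≤ k * d := by gcongr
                linarith
      · intro m hm
        rw [if_neg hm]; simp [hd]
    refine (ENNReal.tsum_le_tsum hk).trans ?_
    rw [← ENNReal.ofReal_tsum_of_nonneg (fun k => by positivity)
      ((summable_geometric_of_lt_one hr0.le hr1).mul_left _)]
    apply ENNReal.ofReal_le_ofReal
    rw [tsum_mul_left, tsum_geometric_of_lt_one hr0.le hr1]
    refine le_trans (le_of_eq ?_) hL2
    ring

/-- the direction with angle θ -/
def ev (θ : ℝ) : Plane := !₂[Real.cos θ, Real.sin θ]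

lemma ev_zero (θ : ℝ) : ev θ 0 = Real.cos θ := by simp [ev]

lemma ev_one (θ : ℝ) : ev θ 1 = Real.sin θ := by simp [ev]

lemma ev_mem (θ : ℝ) : ev θ ∈ unitCircle := by
  rw [unitCircle, mem_sphere_zero_iff_norm, EuclideanSpace.norm_eq]
  simp [Fin.sum_univ_two, ev_zero, ev_one]

lemma ev_lip : LipschitzWith 2 ev := by
  apply LipschitzWith.of_dist_le_mul
  intro x y
  rw [EuclideanSpace.dist_eq, Fin.sum_univ_two, ev_zero, ev_zero, ev_one, ev_one]
  apply Real.sqrt_le_iff.mpr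
  refine ⟨by positivity, ?_⟩
  have h1 : dist (Real.cos x) (Real.cos y) ≤ dist x y := by
    rw [Real.dist_eq, Real.dist_eq]; exact Real.abs_cos_sub_cos_le x y
  have h2 : dist (Real.sin x) (Real.sin y) ≤ dist x y := by
    rw [Real.dist_eq, Real.dist_eq]; exact Real.abs_sin_sub_sin_le x y
  have h3 : dist (Real.cos x) (Real.cos y) ^ 2 ≤ dist x y ^ 2 := by gcongr
  have h4 : dist (Real.sin x) (Real.sin y) ^ 2 ≤ dist x y ^ 2 := by gcongr
  have : (((2:ℝ≥0):ℝ) * dist x y)^2 = 4 * dist x y ^ 2 := by push_cast; ring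
  rw [this]
  nlinarith [sq_nonneg (dist x y)]

lemma exists_ev {e : Plane} (he : e ∈ unitCircle) : ∃ θ ∈ Ioc (-Real.pi) Real.pi, ev θ = e := by
  rw [unitCircle, mem_sphere_zero_iff_norm, EuclideanSpace.norm_eq, Real.sqrt_eq_one,
    Fin.sum_univ_two] at he
  simp only [Real.norm_eq_abs, sq_abs] at he
  let c : ℂ := ⟨e 0, e 1⟩
  have hc : ‖c‖ = 1 := by
    rw [Complex.norm_def, Real.sqrt_eq_one, Complex.normSq_mk]; linarith
  have hc0 : c ≠ 0 := by intro h; rw [h] at hc; simp at hc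
  refine ⟨Complex.arg c, Complex.arg_mem_Ioc c, ?_⟩
  ext i
  fin_cases i
  · change ev _ 0 = e 0
    rw [ev_zero, Complex.cos_arg hc0, hc]; simp [c]
  · change ev _ 1 = e 1
    rw [ev_one, Complex.sin_arg, hc]; simp [c]

lemma pp_line (θ : ℝ) {z w : Plane} (hw : w ∈ lineThrough (ev θ) z) : pp θ w = pp θ z := by
  obtain ⟨r, rfl⟩ := hw
  simp only [pp, PiLp.add_apply, PiLp.smul_apply, ev_zero, ev_one, smul_eq_mul]
  ring

lemma cov_le_tube {K : Set Plane} (hb : Bornology.IsBounded K) (θ : ℝ) (k : ℕ) (z : Plane) :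
    covNum 2 k (K ∩ lineThrough (ev θ) z) ≤ (tube hb θ k z).card := by
  rw [covNum_eq, ← Set.ncard_coe_finset]
  apply Set.ncard_le_ncard _ (Finset.finite_toSet _)
  rintro _ ⟨w, ⟨hwK, hw⟩, rfl⟩
  rw [Finset.mem_coe, mem_tube, mem_PP]
  refine ⟨⟨w, hwK, rfl⟩, ?_⟩
  rw [← pp_line θ hw]
  linarith [prj_idx θ k w]

lemma step {K : Set Plane} {t s : ℝ} (hK : IsCompact K) (hne : K.Nonempty) (C : ℝ) (hC : 0 < C)
    (hsub : ∀ j k : ℕ, j ≤ k → ∀ m : Fin 2 → ℤ, (dyadicCube 2 j m ∩ K).Nonempty →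
    (covNum 2 j K : ℝ) * (covNum 2 k (K ∩ dyadicCube 2 j m) : ℝ) ≤ C * (covNum 2 k K : ℝ))
    (ht : dimH K = ENNReal.ofReal t) (ht0 : 0 < t) (hs : 0 < s)
    (ε : ℝ) (hε : 0 < ε) (hεs : ε ≤ s) (hε4 : ε ≤ (1 + s - t) / 4) :
    ∀ᵐ θ ∂(volume.restrict (Ioc (-Real.pi) Real.pi)),
      dimH (heavyPart K (ev θ) s) ≤ ENNReal.ofReal (max (t - s) 0 + 5 * ε) := by
  have hb : Bornology.IsBounded K := hK.isBounded
  set η : ℝ := 1 + s - t - 3 * ε with hηd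
  have hη : 0 < η := by linarith
  obtain ⟨q, hq⟩ : ∃ q : ℕ, 16 * C * (2:ℝ)^(-(((q + 4 : ℕ):ℝ) * η)) ≤ 1/2 := by
    have hlim : Filter.Tendsto (fun k : ℕ => 16 * C * ((2:ℝ)^(-η))^(k+4)) Filter.atTop
        (nhds (16 * C * 0)) := by
      apply Filter.Tendsto.const_mul
      refine (Filter.tendsto_add_atTop_iff_nat 4).mpr ?_
      apply tendsto_pow_atTop_nhds_zero_of_lt_one (by positivity)
      exact Real.rpow_lt_one_of_one_lt_of_neg (by norm_num) (by linarith)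
    rw [mul_zero] at hlim
    obtain ⟨q, hq⟩ := (hlim.eventually_le_const (by norm_num : (0:ℝ) < 1/2)).exists
    refine ⟨q, le_trans (le_of_eq ?_) hq⟩
    rw [← Real.rpow_natCast, ← Real.rpow_mul (by norm_num)]
    congr 2; ring
  have hPne : ∀ k, (PP hb k).Nonempty := by
    intro k
    obtain ⟨z, hz⟩ := hne
    exact ⟨idx k z, (mem_PP hb k _).mpr ⟨z, hz, rfl⟩⟩
  have hen := energy_ae (A := 2^q) (one_le_pow₀ (by norm_num)) (PP hb) hPne ε hε
  filter_upwards [hen] with θ hθ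
  obtain ⟨D, hD, hen⟩ := hθ
  set d : ℝ := max (t - s) 0 + 5 * ε with hdd
  have hd : 0 < d := by have := le_max_right (t - s) 0; linarith
  have hz : μH[d] (heavyPart K (ev θ) s) = 0 := by
    apply zero_meas hb hne C hC hsub η hη q hq θ ε d D hε hd
      (by have := le_max_left (t - s) 0; linarith) hD hen _ (fun z hz => hz.1)
    intro z hz L
    have h1 : ∀ᶠ k : ℕ in Filter.atTop,
        (2:ℝ)^(k * (s - ε)) < (covNum 2 k (K ∩ lineThrough (ev θ) z) : ℝ) := by
      by_contra hcon
      have h2 : ∃ᶠ k : ℕ in Filter.atTop,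
          (covNum 2 k (K ∩ lineThrough (ev θ) z) : ℝ) ≤ (2:ℝ)^(k * (s - ε)) := by
        intro h3
        apply hcon
        filter_upwards [h3] with k hk using not_le.mp hk
      have h3 := hz.2.trans (dim_le_of_cov (hb.subset inter_subset_left) (s - ε) (by linarith) h2)
      rw [ENNReal.ofReal_le_ofReal_iff (by linarith)] at h3
      linarith
    have h2 := freq_small hK hne C hC hsub (t + ε) (by linarith) (by
      rw [ht]; exact (ENNReal.ofReal_lt_ofReal_iff (by linarith)).mpr (by linarith))
    have h3 : ∀ᶠ k : ℕ in Filter.atTop, L ≤ ((2:ℝ)^ε)^k :=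
      (tendsto_pow_atTop_atTop_of_one_lt
        (Real.one_lt_rpow (by norm_num) hε)).eventually_ge_atTop L
    obtain ⟨k, hk2, hk1, hk3⟩ := (h2.and_eventually (h1.and h3)).exists
    refine ⟨k, ?_⟩
    have h4 : (covNum 2 k (K ∩ lineThrough (ev θ) z) : ℝ) ≤ (tube hb θ k z).card := by
      exact_mod_cast cov_le_tube hb θ k z
    refine le_trans ?_ (hk1.le.trans h4)
    rw [card_PP]
    calc L * (2:ℝ)^((k:ℝ) * (η - 1)) * (covNum 2 k K : ℝ)
        ≤ ((2:ℝ)^ε)^k * (2:ℝ)^((k:ℝ) * (η - 1)) * (2:ℝ)^(k * (t + ε)) := by gcongr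
      _ = (2:ℝ)^(k * (s - ε)) := by
        rw [← Real.rpow_natCast, ← Real.rpow_mul (by norm_num), ← Real.rpow_add (by norm_num),
          ← Real.rpow_add (by norm_num)]
        congr 1; rw [hηd]; ring
  have := dimH_le_of_hausdorffMeasure_ne_top (s := heavyPart K (ev θ) s) (d := ⟨d, hd.le⟩) (by
      change μH[d] _ ≠ ∞
      rw [hz]; simp)
  refine this.trans (le_of_eq ?_)
  rw [ENNReal.ofReal, Real.toNNReal_of_nonneg hd.le]; rfl

theorem statement4 (K : Set Plane) (t s : ℝ)
    (hK : IsCompact K) (hsub : SubUniformlyDistributed K)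
    (ht : dimH K = ENNReal.ofReal t) (ht0 : 0 < t) (ht2 : t < 2)
    (hs1 : max (t - 1) 0 < s) (hs2 : s ≤ 1) :
    ∃ E : Set Plane, E ⊆ unitCircle ∧ μH[1] E = 0 ∧
      ∀ e ∈ unitCircle \ E,
        dimH (heavyPart K e s) ≤ ENNReal.ofReal (max (t - s) 0) := by
  obtain ⟨C, hC, hsub⟩ := hsub.2
  have hne : K.Nonempty := by
    rw [Set.nonempty_iff_ne_empty]
    rintro rfl
    rw [dimH_empty] at ht
    have := ENNReal.ofReal_pos.mpr ht0
    rw [← ht] at this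
    exact lt_irrefl _ this
  have hs : 0 < s := lt_of_le_of_lt (le_max_right _ _) hs1
  have hst : t - 1 < s := lt_of_le_of_lt (le_max_left _ _) hs1
  set ε0 : ℝ := min s ((1 + s - t) / 4) with hε0
  have hε0p : 0 < ε0 := lt_min hs (by linarith)
  have hall : ∀ᵐ θ ∂(volume.restrict (Ioc (-Real.pi) Real.pi)), ∀ n : ℕ,
      dimH (heavyPart K (ev θ) s) ≤
        ENNReal.ofReal (max (t - s) 0 + 5 * (ε0 * (1 / ((n:ℝ) + 1)))) := by
    rw [ae_all_iff]
    intro n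
    have h1 : 1 / ((n:ℝ) + 1) ≤ 1 := by
      rw [div_le_one (by positivity)]
      have : (0:ℝ) ≤ n := Nat.cast_nonneg n
      linarith
    have h2 : ε0 * (1 / ((n:ℝ) + 1)) ≤ ε0 := mul_le_of_le_one_right hε0p.le h1
    exact step hK hne C hC hsub ht ht0 hs _ (by positivity)
      (h2.trans (min_le_left _ _)) (h2.trans (min_le_right _ _))
  rw [ae_restrict_iff' measurableSet_Ioc, ae_iff] at hall
  refine ⟨ev '' {θ | ¬(θ ∈ Ioc (-Real.pi) Real.pi → ∀ n : ℕ, dimH (heavyPart K (ev θ) s) ≤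
        ENNReal.ofReal (max (t - s) 0 + 5 * (ε0 * (1 / ((n:ℝ) + 1)))))}, ?_, le_antisymm
    ((ev_lip.hausdorffMeasure_image_le (zero_le_one) _).trans (le_of_eq ?_)) zero_le, ?_⟩
  · rintro _ ⟨θ, _, rfl⟩
    exact ev_mem θ
  · rw [hausdorffMeasure_real, hall, mul_zero]
  · rintro e ⟨he, heE⟩
    obtain ⟨θ, hθ, rfl⟩ := exists_ev he
    have hgood : ∀ n : ℕ, dimH (heavyPart K (ev θ) s) ≤
        ENNReal.ofReal (max (t - s) 0 + 5 * (ε0 * (1 / ((n:ℝ) + 1)))) := by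
      by_contra hcon
      exact heE ⟨θ, fun h => hcon (h hθ), rfl⟩
    have hl : Filter.Tendsto (fun n : ℕ => ENNReal.ofReal
        (max (t - s) 0 + 5 * (ε0 * (1 / ((n:ℝ) + 1))))) Filter.atTop
        (nhds (ENNReal.ofReal (max (t - s) 0 + 5 * (ε0 * 0)))) :=
      ENNReal.tendsto_ofReal (tendsto_const_nhds.add
        ((tendsto_one_div_add_atTop_nhds_zero_nat.const_mul ε0).const_mul 5))
    rw [mul_zero, mul_zero, add_zero] at hl
    exact ge_of_tendsto' hl hgood
end
end

section
/- If K ⊆ ℝ^d is compact and sub-uniformly distributed, then the Hausdorff dimension of K equals the lower box dimension of K. -/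
open MeasureTheory Metric Set
open scoped ENNReal NNReal

noncomputable section

/-- The lower box (Minkowski) dimension, computed along dyadic scales:
`liminf_{k→∞} log |A|_{2^{-k}} / log (2^k)`. -/
def lowerBoxDim {d : ℕ} (A : Set (EuclideanSpace ℝ (Fin d))) : ℝ :=
  Filter.liminf (fun k : ℕ => Real.log (covNum d k A) / ((k : ℝ) * Real.log 2)) Filter.atTop

/-- The upper box (Minkowski) dimension, computed along dyadic scales:
`limsup_{k→∞} log |A|_{2^{-k}} / log (2^k)`. -/
def upperBoxDim {d : ℕ} (A : Set (EuclideanSpace ℝ (Fin d))) : ℝ :=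
  Filter.limsup (fun k : ℕ => Real.log (covNum d k A) / ((k : ℝ) * Real.log 2)) Filter.atTop

/-- Index of the dyadic cube of side `2^{-k}` containing `x`. -/
def dyIdx (d k : ℕ) (x : EuclideanSpace ℝ (Fin d)) : Fin d → ℤ := fun i => ⌊x i * 2 ^ k⌋

lemma mem_dyadicCube_iff (d k : ℕ) (m : Fin d → ℤ) (x : EuclideanSpace ℝ (Fin d)) :
    x ∈ dyadicCube d k m ↔ dyIdx d k x = m := by
  have h2 : (0 : ℝ) < 2 ^ k := by positivity
  simp only [dyadicCube, mem_ofPred_eq, dyIdx, funext_iff, Int.floor_eq_iff]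
  refine forall_congr' fun i => ?_
  rw [zpow_neg, zpow_natCast, ← div_eq_mul_inv, ← div_eq_mul_inv, div_le_iff₀ h2, lt_div_iff₀ h2]

lemma covNum_eq_s9 (d k : ℕ) (P : Set (EuclideanSpace ℝ (Fin d))) :
    covNum d k P = (dyIdx d k '' P).ncard := by
  unfold covNum
  congr 1
  ext m
  simp only [mem_ofPred_eq, Set.Nonempty, mem_inter_iff, mem_dyadicCube_iff, mem_image]
  exact exists_congr fun x => and_comm

lemma exists_box (d : ℕ) {K : Set (EuclideanSpace ℝ (Fin d))} (hK : Bornology.IsBounded K) :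
    ∃ B : ℕ, 1 ≤ B ∧ ∀ k : ℕ, (dyIdx d k '' K).Finite ∧ (covNum d k K) ≤ (B * 2 ^ k) ^ d := by
  obtain ⟨R, hR⟩ := hK.exists_norm_le
  obtain ⟨b, hb⟩ := exists_nat_ge R
  refine ⟨2 * b + 1, by omega, fun k => ?_⟩
  have h2 : (0 : ℝ) < 2 ^ k := by positivity
  have hsub : dyIdx d k '' K ⊆
      (Fintype.piFinset (fun _ : Fin d => Finset.Icc (-((b : ℤ) * 2 ^ k)) ((b : ℤ) * 2 ^ k)) :
        Finset (Fin d → ℤ)) := by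
    rintro _ ⟨x, hx, rfl⟩
    simp only [Finset.mem_coe, Fintype.mem_piFinset, Finset.mem_Icc, dyIdx]
    intro i
    have hxi : |x i| ≤ b := by
      have := PiLp.norm_apply_le x i
      rw [Real.norm_eq_abs] at this
      exact this.trans ((hR x hx).trans hb)
    rw [abs_le] at hxi
    constructor
    · rw [Int.le_floor]
      push_cast
      nlinarith
    · have : (⌊x i * 2 ^ k⌋ : ℝ) ≤ (b : ℝ) * 2 ^ k :=
        (Int.floor_le _).trans (by nlinarith)
      have h3 : ((⌊x i * 2 ^ k⌋ : ℤ) : ℝ) ≤ (((b : ℤ) * 2 ^ k : ℤ) : ℝ) := by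
        push_cast
        exact this
      exact Int.cast_le.1 h3
  refine ⟨(Finset.finite_toSet _).subset hsub, ?_⟩
  rw [covNum_eq_s9]
  refine (Set.ncard_le_ncard hsub (Finset.finite_toSet _)).trans ?_
  rw [Set.ncard_coe_finset, Fintype.card_piFinset]
  simp only [Int.card_Icc, Finset.prod_const, Finset.card_univ, Fintype.card_fin]
  gcongr
  have : (1 : ℤ) ≤ 2 ^ k := one_le_pow₀ (by norm_num)
  rw [Int.toNat_le]
  push_cast
  nlinarith

lemma covNum_pos (d k : ℕ) {K : Set (EuclideanSpace ℝ (Fin d))} (hK : Bornology.IsBounded K)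
    (hne : K.Nonempty) : 1 ≤ covNum d k K := by
  obtain ⟨B, -, hB⟩ := exists_box d hK
  rw [covNum_eq_s9, Nat.one_le_iff_ne_zero, Ne, Set.ncard_eq_zero (hB k).1]
  exact (hne.image _).ne_empty

lemma seq_nonneg (d : ℕ) (K : Set (EuclideanSpace ℝ (Fin d))) (k : ℕ) :
    0 ≤ Real.log (covNum d k K) / ((k : ℝ) * Real.log 2) :=
  div_nonneg (Real.log_natCast_nonneg _) (mul_nonneg (by positivity) (Real.log_nonneg (by norm_num)))

lemma seq_bdd (d : ℕ) {K : Set (EuclideanSpace ℝ (Fin d))} (hK : Bornology.IsBounded K)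
    (hne : K.Nonempty) : ∃ M : ℝ, ∀ k : ℕ,
    Real.log (covNum d k K) / ((k : ℝ) * Real.log 2) ≤ M := by
  obtain ⟨B, hB1, hB⟩ := exists_box d hK
  have hl : 0 < Real.log 2 := Real.log_pos (by norm_num)
  have hlB : 0 ≤ Real.log B := Real.log_natCast_nonneg _
  refine ⟨d * (Real.log B / Real.log 2 + 1), fun k => ?_⟩
  rcases Nat.eq_zero_or_pos k with rfl | hk
  · simp; positivity
  have hk' : (1 : ℝ) ≤ k := by exact_mod_cast hk
  rw [div_le_iff₀ (by positivity)]
  have h1 : (covNum d k K : ℝ) ≤ ((B : ℝ) * 2 ^ k) ^ d := by exact_mod_cast (hB k).2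
  have h0 : (0 : ℝ) < covNum d k K := by exact_mod_cast covNum_pos d k hK hne
  have hB0 : (0 : ℝ) < B := by exact_mod_cast hB1
  have h3 := Real.log_le_log h0 h1
  rw [Real.log_pow, Real.log_mul (by positivity) (by positivity), Real.log_pow] at h3
  refine h3.trans ?_
  have : (d : ℝ) * (Real.log B / Real.log 2 + 1) * (k * Real.log 2)
      = d * (k * Real.log B + k * Real.log 2) := by
    field_simp
  rw [this]
  gcongr
  nlinarith

lemma bdd_below (d : ℕ) (K : Set (EuclideanSpace ℝ (Fin d))) :
    Filter.IsBoundedUnder (· ≥ ·) Filter.atTop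
      (fun k : ℕ => Real.log (covNum d k K) / ((k : ℝ) * Real.log 2)) :=
  ⟨0, Filter.eventually_map.2 (Filter.Eventually.of_forall (seq_nonneg d K))⟩

lemma cobdd (d : ℕ) {K : Set (EuclideanSpace ℝ (Fin d))} (hK : Bornology.IsBounded K)
    (hne : K.Nonempty) :
    Filter.IsCoboundedUnder (· ≥ ·) Filter.atTop
      (fun k : ℕ => Real.log (covNum d k K) / ((k : ℝ) * Real.log 2)) := by
  obtain ⟨M, hM⟩ := seq_bdd d hK hne
  exact Filter.IsBoundedUnder.isCoboundedUnder_ge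
    ⟨M, Filter.eventually_map.2 (Filter.Eventually.of_forall hM)⟩

lemma lowerBoxDim_nonneg (d : ℕ) {K : Set (EuclideanSpace ℝ (Fin d))} (hK : Bornology.IsBounded K)
    (hne : K.Nonempty) : 0 ≤ lowerBoxDim K :=
  Filter.le_liminf_of_le (cobdd d hK hne) (Filter.Eventually.of_forall (seq_nonneg d K))

lemma ediam_cube (d k : ℕ) (m : Fin d → ℤ) :
    ediam (dyadicCube d k m) ≤ ENNReal.ofReal ((d + 1) * (2⁻¹ : ℝ) ^ k) := by
  refine Metric.ediam_le fun x hx y hy => ?_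
  rw [edist_dist]
  refine ENNReal.ofReal_le_ofReal ?_
  have h2 : (0 : ℝ) < 2⁻¹ ^ k := by positivity
  rw [EuclideanSpace.dist_eq]
  refine Real.sqrt_le_iff.2 ⟨by positivity, ?_⟩
  have : ∀ i ∈ Finset.univ, dist (x i) (y i) ^ 2 ≤ ((2⁻¹ : ℝ) ^ k) ^ 2 := by
    intro i _
    have hx := hx i
    have hy := hy i
    rw [zpow_neg, zpow_natCast, ← inv_pow] at hx hy
    rw [Real.dist_eq]
    gcongr
    rw [abs_le]
    constructor <;> nlinarith
  refine (Finset.sum_le_card_nsmul _ _ _ this).trans ?_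
  simp only [Finset.card_univ, Fintype.card_fin, nsmul_eq_mul]
  rw [mul_pow]
  gcongr
  nlinarith [(Nat.cast_nonneg d : (0 : ℝ) ≤ d)]

lemma upper (d : ℕ) {K : Set (EuclideanSpace ℝ (Fin d))} (hK : Bornology.IsBounded K)
    (hne : K.Nonempty) (s : ℝ≥0) (hs : lowerBoxDim K < s) : dimH K ≤ s := by
  apply dimH_le_of_hausdorffMeasure_ne_top
  obtain ⟨B, hB1, hB⟩ := exists_box d hK
  have hl : 0 < Real.log 2 := Real.log_pos (by norm_num)
  have hf : ∃ᶠ k : ℕ in Filter.atTop, (covNum d k K : ℝ) ≤ (2 : ℝ) ^ ((k : ℝ) * s) := by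
    have h := Filter.frequently_lt_of_liminf_lt (cobdd d hK hne) hs
    refine (h.and_eventually (Filter.eventually_ge_atTop 1)).mono ?_
    rintro k ⟨hk, hk1⟩
    have hk' : (1 : ℝ) ≤ k := by exact_mod_cast hk1
    have h0 : (0 : ℝ) < covNum d k K := by exact_mod_cast covNum_pos d k hK hne
    rw [div_lt_iff₀ (by positivity)] at hk
    rw [← Real.log_le_log_iff h0 (by positivity), Real.log_rpow (by norm_num)]
    linarith
  have : ∀ k, Fintype (dyIdx d k '' K) := fun k => (hB k).1.fintype
  have key := Measure.hausdorffMeasure_le_liminf_sum (ι := fun k : ℕ => (dyIdx d k '' K : Set _))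
    (s : ℝ) K (l := Filter.atTop) (fun k : ℕ => ENNReal.ofReal ((d + 1) * (2⁻¹ : ℝ) ^ k))
    (by
      rw [← ENNReal.ofReal_zero]
      apply ENNReal.tendsto_ofReal
      have := (tendsto_pow_atTop_nhds_zero_of_lt_one (r := (2⁻¹ : ℝ)) (by norm_num)
        (by norm_num)).const_mul ((d : ℝ) + 1)
      simpa using this)
    (fun k m => dyadicCube d k m)
    (Filter.Eventually.of_forall fun k m => ediam_cube d k m)
    (Filter.Eventually.of_forall fun k x hx => mem_iUnion.2
      ⟨⟨dyIdx d k x, mem_image_of_mem _ hx⟩, (mem_dyadicCube_iff _ _ _ _).2 rfl⟩)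
  refine ne_top_of_le_ne_top ?_ (key.trans (Filter.liminf_le_of_frequently_le'
    (x := ENNReal.ofReal (((d : ℝ) + 1) ^ (s : ℝ))) ?_))
  · exact ENNReal.ofReal_ne_top
  refine hf.mono fun k hk => ?_
  have hsum : ∑ i : (dyIdx d k '' K : Set _), ediam (dyadicCube d k i) ^ (s : ℝ) ≤
      ∑ i : (dyIdx d k '' K : Set _), ENNReal.ofReal (((d + 1) * (2⁻¹ : ℝ) ^ k) ^ (s : ℝ)) := by
    refine Finset.sum_le_sum fun i _ => ?_
    rw [← ENNReal.ofReal_rpow_of_nonneg (by positivity) (by positivity)]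
    exact ENNReal.rpow_le_rpow (ediam_cube d k i) (by positivity)
  refine hsum.trans ?_
  rw [Finset.sum_const, Finset.card_univ, ← Set.toFinset_card, ← Set.ncard_eq_toFinset_card',
    ← covNum_eq_s9, nsmul_eq_mul, ← ENNReal.ofReal_natCast, ← ENNReal.ofReal_mul (by positivity)]
  apply ENNReal.ofReal_le_ofReal
  rw [Real.mul_rpow (by positivity) (by positivity)]
  have e : ((2⁻¹ : ℝ) ^ k) ^ (s : ℝ) = ((2 : ℝ) ^ ((k : ℝ) * s))⁻¹ := by
    rw [Real.rpow_mul (by norm_num), Real.rpow_natCast, inv_pow, Real.inv_rpow (by positivity)]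
  rw [e]
  have hp : (0 : ℝ) < (2 : ℝ) ^ ((k : ℝ) * s) := by positivity
  have hd : (0 : ℝ) < ((d : ℝ) + 1) ^ (s : ℝ) := by positivity
  calc (covNum d k K : ℝ) * (((d : ℝ) + 1) ^ (s : ℝ) * ((2 : ℝ) ^ ((k : ℝ) * s))⁻¹)
      ≤ (2 : ℝ) ^ ((k : ℝ) * s) * (((d : ℝ) + 1) ^ (s : ℝ) * ((2 : ℝ) ^ ((k : ℝ) * s))⁻¹) := by
        gcongr
    _ = _ := by field_simp

/-- Finite covering estimate. -/
lemma cover_est (d : ℕ) {K : Set (EuclideanSpace ℝ (Fin d))} (hK : Bornology.IsBounded K)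
    (hne : K.Nonempty) (C : ℝ) (hC : ∀ j k : ℕ, j ≤ k → ∀ m : Fin d → ℤ,
    (dyadicCube d j m ∩ K).Nonempty →
    (covNum d j K : ℝ) * (covNum d k (K ∩ dyadicCube d j m) : ℝ) ≤ C * (covNum d k K : ℝ))
    (hC0 : 0 < C) (F : Finset ℕ) (x : ℕ → EuclideanSpace ℝ (Fin d)) (j : ℕ → ℕ)
    (hcov : K ⊆ ⋃ n ∈ F, ball (x n) (2 * (2⁻¹ : ℝ) ^ (j n))) :
    1 ≤ ∑ n ∈ F, 5 ^ d * (C / covNum d (j n) K) := by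
  obtain ⟨B, hB1, hB⟩ := exists_box d hK
  set k := F.sup j with hk
  set S : ℕ → Finset (Fin d → ℤ) := fun n => Fintype.piFinset
    (fun i => Finset.Icc (dyIdx d (j n) (x n) i - 2) (dyIdx d (j n) (x n) i + 2)) with hS
  have hfin : ∀ P : Set (EuclideanSpace ℝ (Fin d)), (dyIdx d k '' (K ∩ P)).Finite := fun P =>
    (hB k).1.subset (image_mono inter_subset_left)
  have hsub : dyIdx d k '' K ⊆
      ⋃ n ∈ F, ⋃ m ∈ S n, dyIdx d k '' (K ∩ dyadicCube d (j n) m) := by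
    rintro _ ⟨y, hy, rfl⟩
    obtain ⟨n, hn, hyn⟩ := mem_iUnion₂.1 (hcov hy)
    refine mem_iUnion₂.2 ⟨n, hn, mem_iUnion₂.2 ⟨dyIdx d (j n) y, ?_,
      mem_image_of_mem _ ⟨hy, (mem_dyadicCube_iff _ _ _ _).2 rfl⟩⟩⟩
    simp only [hS, Fintype.mem_piFinset, Finset.mem_Icc]
    intro i
    have h2 : (0 : ℝ) < 2 ^ (j n) := by positivity
    have h1 : |y i - x n i| < 2 * (2⁻¹ : ℝ) ^ (j n) := by
      have := PiLp.norm_apply_le (y - x n) i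
      rw [Real.norm_eq_abs] at this
      rw [mem_ball, dist_eq_norm] at hyn
      exact lt_of_le_of_lt this hyn
    have h3 : |y i * 2 ^ (j n) - x n i * 2 ^ (j n)| < 2 := by
      rw [← sub_mul, abs_mul, abs_of_pos h2]
      rw [inv_pow, ← div_eq_mul_inv, lt_div_iff₀ h2] at h1
      exact h1
    rw [abs_lt] at h3
    have a1 := Int.floor_le (y i * 2 ^ (j n))
    have a2 := Int.lt_floor_add_one (y i * 2 ^ (j n))
    have b1 := Int.floor_le (x n i * 2 ^ (j n))
    have b2 := Int.lt_floor_add_one (x n i * 2 ^ (j n))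
    simp only [dyIdx]
    constructor
    · have : ((⌊x n i * 2 ^ (j n)⌋ : ℤ) : ℝ) - 2 < (⌊y i * 2 ^ (j n)⌋ : ℤ) + 1 := by linarith
      have : ⌊x n i * 2 ^ (j n)⌋ - 2 < ⌊y i * 2 ^ (j n)⌋ + 1 := by
        rw [← Int.cast_lt (R := ℝ)]
        push_cast
        exact this
      omega
    · have : ((⌊y i * 2 ^ (j n)⌋ : ℤ) : ℝ) < (⌊x n i * 2 ^ (j n)⌋ : ℤ) + 3 := by linarith
      have : ⌊y i * 2 ^ (j n)⌋ < ⌊x n i * 2 ^ (j n)⌋ + 3 := by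
        rw [← Int.cast_lt (R := ℝ)]
        push_cast
        exact this
      omega
  have hN : covNum d k K ≤ ∑ n ∈ F, ∑ m ∈ S n, covNum d k (K ∩ dyadicCube d (j n) m) := by
    simp only [covNum_eq_s9]
    refine (Set.ncard_le_ncard hsub ?_).trans ?_
    · exact F.finite_toSet.biUnion fun n _ => (S n).finite_toSet.biUnion fun m _ => hfin _
    · refine (Finset.set_ncard_biUnion_le _ _).trans (Finset.sum_le_sum fun n _ => ?_)
      exact Finset.set_ncard_biUnion_le _ _
  have hpos : ∀ l, (0 : ℝ) < covNum d l K := fun l => by exact_mod_cast covNum_pos d l hK hne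
  have hN' : (covNum d k K : ℝ) ≤
      ∑ n ∈ F, 5 ^ d * (C / covNum d (j n) K) * covNum d k K := by
    refine le_trans (by exact_mod_cast hN : (covNum d k K : ℝ) ≤
      ∑ n ∈ F, ∑ m ∈ S n, (covNum d k (K ∩ dyadicCube d (j n) m) : ℝ)) ?_
    refine Finset.sum_le_sum fun n hn => ?_
    have hcard : (S n).card = 5 ^ d := by
      simp only [hS, Fintype.card_piFinset, Int.card_Icc]
      have : ∀ a : ℤ, (a + 2 + 1 - (a - 2)).toNat = 5 := fun a => by
        rw [show a + 2 + 1 - (a - 2) = 5 by ring]; rfl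
      simp [this]
    refine (Finset.sum_le_card_nsmul _ _ (C / covNum d (j n) K * covNum d k K) ?_).trans ?_
    · intro m _
      by_cases hm : (dyadicCube d (j n) m ∩ K).Nonempty
      · have := hC (j n) k (Finset.le_sup hn) m hm
        rw [div_mul_eq_mul_div, le_div_iff₀ (hpos _)]
        linarith
      · rw [Set.not_nonempty_iff_eq_empty, inter_comm] at hm
        rw [hm, covNum_eq_s9]
        simp only [image_empty, ncard_empty, Nat.cast_zero]
        have := hpos (j n)
        positivity
    · rw [hcard, nsmul_eq_mul]
      push_cast
      rw [mul_assoc]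
  rw [← Finset.sum_mul] at hN'
  exact le_of_mul_le_mul_right (by linarith) (hpos k)

lemma exists_scale (s a e : ℝ) (hs : 0 < s) (ha0 : 0 ≤ a) (ha : a ≤ 1) (he : 0 < e) (he1 : e ≤ 1) :
    ∃ j : ℕ, a ≤ (2⁻¹ : ℝ) ^ j ∧ ((2⁻¹ : ℝ) ^ j) ^ s ≤ 2 ^ s * (a ^ s + e) := by
  have hη : 0 < e ^ (s⁻¹) := Real.rpow_pos_of_pos he _
  have hη1 : e ^ (s⁻¹) ≤ 1 := Real.rpow_le_one he.le he1 (by positivity)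
  obtain ⟨j, hj1, hj2⟩ := exists_nat_pow_near_of_lt_one (lt_max_of_lt_right hη : 0 < max a _)
    (max_le ha hη1) (by norm_num : (0 : ℝ) < 2⁻¹) (by norm_num)
  refine ⟨j, (le_max_left _ _).trans hj2, ?_⟩
  have h1 : (2⁻¹ : ℝ) ^ j ≤ 2 * max a (e ^ (s⁻¹)) := by
    rw [pow_succ] at hj1
    linarith
  refine (Real.rpow_le_rpow (by positivity) h1 hs.le).trans ?_
  rw [Real.mul_rpow (by norm_num) (by positivity)]
  gcongr
  have has : 0 ≤ a ^ s := Real.rpow_nonneg ha0 s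
  rcases max_choice a (e ^ (s⁻¹)) with h | h <;> rw [h]
  · linarith
  · rw [Real.rpow_inv_rpow he.le hs.ne']
    linarith

lemma lower (d : ℕ) {K : Set (EuclideanSpace ℝ (Fin d))} (hK : IsCompact K)
    (hne : K.Nonempty) (hsub : SubUniformlyDistributed K) (s : ℝ≥0) (hs0 : 0 < s)
    (hs : (s : ℝ) < lowerBoxDim K) : (s : ℝ≥0∞) ≤ dimH K := by
  obtain ⟨hbd, C, hC0, hC⟩ := hsub
  apply le_dimH_of_hausdorffMeasure_ne_zero
  intro hzero
  have hsp : (0 : ℝ) < s := hs0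
  have hl : 0 < Real.log 2 := Real.log_pos (by norm_num)
  have hpos : ∀ l, (1 : ℝ) ≤ covNum d l K := fun l => by exact_mod_cast covNum_pos d l hbd hne
  -- lower bound for covering numbers
  obtain ⟨c, hc0, hc⟩ : ∃ c : ℝ, 0 < c ∧ ∀ k : ℕ, 1 / (covNum d k K : ℝ) ≤
      c * ((2⁻¹ : ℝ) ^ k) ^ (s : ℝ) := by
    have h := Filter.eventually_lt_of_lt_liminf hs (bdd_below d K)
    obtain ⟨k0, hk0⟩ := Filter.eventually_atTop.1 (h.and (Filter.eventually_ge_atTop 1))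
    have e : ∀ k : ℕ, ((2⁻¹ : ℝ) ^ k) ^ (s : ℝ) = ((2 : ℝ) ^ ((k : ℝ) * s))⁻¹ := fun k => by
      rw [Real.rpow_mul (by norm_num), Real.rpow_natCast, inv_pow, Real.inv_rpow (by positivity)]
    refine ⟨(2 : ℝ) ^ ((k0 : ℝ) * s), by positivity, fun k => ?_⟩
    have hN := hpos k
    rw [e, ← div_eq_mul_inv, div_le_div_iff₀ (by linarith) (by positivity), one_mul]
    have hone : (1 : ℝ) ≤ (2 : ℝ) ^ ((k0 : ℝ) * s) :=
      Real.one_le_rpow (by norm_num) (by positivity)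
    rcases le_total k k0 with hk | hk
    · have : (2 : ℝ) ^ ((k : ℝ) * s) ≤ (2 : ℝ) ^ ((k0 : ℝ) * s) := by
        apply Real.rpow_le_rpow_of_exponent_le (by norm_num)
        gcongr
      nlinarith
    · obtain ⟨h1, h2⟩ := hk0 k hk
      have hk' : (1 : ℝ) ≤ k := by exact_mod_cast h2
      rw [lt_div_iff₀ (by positivity)] at h1
      have : (2 : ℝ) ^ ((k : ℝ) * s) ≤ covNum d k K := by
        rw [← Real.log_le_log_iff (by positivity) (by linarith), Real.log_rpow (by norm_num)]
        linarith
      nlinarith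
  -- constant
  set A : ℝ := 5 ^ d * C * c * 2 ^ (s : ℝ) with hA
  have hA0 : 0 < A := by positivity
  obtain ⟨ε, hε0, hε1, hεA⟩ : ∃ ε : ℝ, 0 < ε ∧ ε ≤ 1 ∧ A * (2 * ε) < 1 := by
    refine ⟨min 1 (1 / (4 * A)), by positivity, min_le_left _ _, ?_⟩
    have : min 1 (1 / (4 * A)) ≤ 1 / (4 * A) := min_le_right _ _
    calc A * (2 * min 1 (1 / (4 * A))) ≤ A * (2 * (1 / (4 * A))) := by gcongr
      _ = 1 / 2 := by field_simp; norm_num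
      _ < 1 := by norm_num
  -- the cover
  have hcover : ∃ t : ℕ → Set (EuclideanSpace ℝ (Fin d)), K ⊆ ⋃ n, t n ∧
      (∀ n, ediam (t n) ≤ 1) ∧
      ∑' n, ⨆ _ : (t n).Nonempty, ediam (t n) ^ (s : ℝ) < ENNReal.ofReal ε := by
    rw [Measure.hausdorffMeasure_apply] at hzero
    have h1 : _ ≤ (0 : ℝ≥0∞) := hzero ▸ le_iSup₂ (α := ℝ≥0∞) (1 : ℝ≥0∞) one_pos
    have h2 := lt_of_le_of_lt h1 (ENNReal.ofReal_pos.2 hε0)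
    simp only [iInf_lt_iff] at h2
    obtain ⟨t, a, b, h⟩ := h2
    exact ⟨t, a, b, h⟩
  obtain ⟨t, hKt, ht1, hts⟩ := hcover
  have htop : ∀ n, ediam (t n) ≠ ∞ := fun n => ne_top_of_le_ne_top ENNReal.one_ne_top (ht1 n)
  have hta : ∀ n, (ediam (t n)).toReal ≤ 1 := fun n => by
    simpa using ENNReal.toReal_mono ENNReal.one_ne_top (ht1 n)
  obtain ⟨δ, hδ0, hδs⟩ := ENNReal.exists_pos_sum_of_countable (ENNReal.ofReal_pos.2 hε0).ne' ℕ
  have hδsum : ∀ F : Finset ℕ, ∑ n ∈ F, (δ n : ℝ) ≤ ε := fun F => by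
    have h := (ENNReal.sum_le_tsum F).trans hδs.le
    rw [← ENNReal.ofReal_le_ofReal_iff hε0.le, ENNReal.ofReal_sum_of_nonneg (fun _ _ => by positivity)]
    simpa using h
  have hδ1 : ∀ n, (δ n : ℝ) ≤ 1 := fun n => by
    have := hδsum {n}
    rw [Finset.sum_singleton] at this
    linarith
  have hasum : ∀ F : Finset ℕ, ∑ n ∈ F, (ediam (t n)).toReal ^ (s : ℝ) ≤ ε := fun F => by
    have h := (ENNReal.sum_le_tsum F).trans hts.le
    rw [← ENNReal.ofReal_le_ofReal_iff hε0.le, ENNReal.ofReal_sum_of_nonneg (fun _ _ => by positivity)]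
    refine le_trans (Finset.sum_le_sum fun n _ => ?_) h
    rw [← ENNReal.ofReal_rpow_of_nonneg (by positivity) hsp.le, ENNReal.ofReal_toReal (htop n)]
    rcases (t n).eq_empty_or_nonempty with h | h
    · simp [h, hsp]
    · simp [h]
  choose j hj1 hj2 using fun n => exists_scale s (ediam (t n)).toReal (δ n) hsp
    ENNReal.toReal_nonneg (hta n) (hδ0 n) (hδ1 n)
  have hx : ∀ n, ∃ x, t n ⊆ ball x (2 * (2⁻¹ : ℝ) ^ (j n)) := fun n => by
    rcases (t n).eq_empty_or_nonempty with h | ⟨x, hx⟩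
    · exact ⟨0, by simp [h]⟩
    · refine ⟨x, fun y hy => ?_⟩
      rw [mem_ball, dist_edist]
      have h1 := ENNReal.toReal_mono (htop n) (Metric.edist_le_ediam_of_mem hy hx)
      have h2 : (0 : ℝ) < 2⁻¹ ^ (j n) := by positivity
      have := hj1 n
      linarith
  choose x hx using hx
  obtain ⟨F, hF⟩ := hK.elim_finite_subcover (fun n => ball (x n) (2 * (2⁻¹ : ℝ) ^ (j n)))
    (fun n => isOpen_ball) (hKt.trans (iUnion_mono hx))
  have h1 := cover_est d hbd hne C hC hC0 F x j hF
  have h2 : ∑ n ∈ F, 5 ^ d * (C / covNum d (j n) K) ≤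
      ∑ n ∈ F, A * ((ediam (t n)).toReal ^ (s : ℝ) + δ n) := by
    refine Finset.sum_le_sum fun n _ => ?_
    calc 5 ^ d * (C / covNum d (j n) K) = 5 ^ d * C * (1 / covNum d (j n) K) := by ring
      _ ≤ 5 ^ d * C * (c * (2 ^ (s : ℝ) * ((ediam (t n)).toReal ^ (s : ℝ) + δ n))) := by
        gcongr
        exact (hc _).trans (by gcongr; exact hj2 n)
      _ = _ := by rw [hA]; ring
  rw [← Finset.mul_sum (f := fun n => (ediam (t n)).toReal ^ (s : ℝ) + (δ n : ℝ)),
    Finset.sum_add_distrib] at h2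
  have h3 := hasum F
  have h4 := hδsum F
  have : A * (∑ n ∈ F, (ediam (t n)).toReal ^ (s : ℝ) + ∑ n ∈ F, (δ n : ℝ)) ≤ A * (2 * ε) := by
    gcongr
    linarith
  linarith

theorem statement9 (d : ℕ) (K : Set (EuclideanSpace ℝ (Fin d)))
    (hK : IsCompact K) (hsub : SubUniformlyDistributed K) :
    dimH K = ENNReal.ofReal (lowerBoxDim K) := by
  rcases K.eq_empty_or_nonempty with rfl | hne
  · have : lowerBoxDim (∅ : Set (EuclideanSpace ℝ (Fin d))) = 0 := by
      simp [lowerBoxDim, covNum_eq_s9]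
    rw [this]
    simp
  have hbd := hsub.1
  have h0 := lowerBoxDim_nonneg d hbd hne
  apply le_antisymm
  · apply le_of_forall_gt_imp_ge_of_dense
    intro b hb
    rcases eq_or_ne b ∞ with rfl | hbt
    · exact le_top
    lift b to ℝ≥0 using hbt
    refine upper d hbd hne b ?_
    rw [← ENNReal.ofReal_coe_nnreal, ENNReal.ofReal_lt_ofReal_iff_of_nonneg h0] at hb
    exact hb
  · apply le_of_forall_lt_imp_le_of_dense
    intro b hb
    have hbt : b ≠ ∞ := hb.ne_top
    lift b to ℝ≥0 using hbt
    rcases eq_or_lt_of_le (zero_le : 0 ≤ b) with h | h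
    · simp [← h]
    refine lower d hK hne hsub b h ?_
    rw [← ENNReal.ofReal_coe_nnreal] at hb
    exact (ENNReal.ofReal_lt_ofReal_iff_of_nonneg b.2).1 hb
end
end
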